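/- arXiv:2503.06020 — 2 statements merged into one kernel-verified Lean document; each statement's English description precedes it below -/
import Mathlib

section
/- Let f : [0,∞) → ℝ be of Allee type (f_A) with zero θ ∈ [0,1). Then there exists a unique θ* ∈ [θ,1) such that ∫₀^{θ*} f(s) ds = 0 and ∫₀^{u} f(s) ds > 0 for every u ∈ (θ*, 1]. -/
open Set Filter

/-- A function `f` is of Allee type `(f_A)` with distinguished zero `θ ∈ [0,1)`. -/
def AlleeType (f : ℝ → ℝ) (θ : ℝ) : Prop :=
  ContDiffOn ℝ 1 f (Ici (0:ℝ)) ∧ θ ∈ Ico (0:ℝ) 1 ∧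
    f 0 = 0 ∧ f θ = 0 ∧ f 1 = 0 ∧
    derivWithin f (Ici (0:ℝ)) 0 ≤ 0 ∧ derivWithin f (Ici (0:ℝ)) 1 < 0 ∧
    (∀ u ∈ Icc (0:ℝ) θ, f u ≤ 0) ∧ (∀ u ∈ Ioo θ (1:ℝ), 0 < f u) ∧
    (∀ u ∈ Ioi (1:ℝ), f u < 0) ∧ 0 < ∫ s in (0:ℝ)..1, f s

/-- `θs` is the number `θ*_f ∈ [θ,1)` attached to an Allee type `f`. -/
def IsThetaStar (f : ℝ → ℝ) (θ θs : ℝ) : Prop :=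
  θs ∈ Ico θ (1:ℝ) ∧ (∫ s in (0:ℝ)..θs, f s) = 0 ∧
    ∀ u ∈ Ioc θs (1:ℝ), 0 < ∫ s in (0:ℝ)..u, f s

/-- Membership in the initial class `X(h₀)`. -/
def InX (δ h₀ : ℝ) (φ : ℝ → ℝ) : Prop :=
  ContDiffOn ℝ 2 φ (Icc (-h₀) h₀) ∧ φ (-h₀) = δ ∧ φ h₀ = δ ∧
    ∀ x ∈ Icc (-h₀) h₀, 0 < φ x

/-- A classical solution `(u,g,h)` of the free boundary problem (with reaction
term `f = f(t,x,u)`) with initial datum `u₀ ∈ X(h₀)` on the time interval `I`. -/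
structure ClassicalSolution (d δ h₀ : ℝ) (f : ℝ → ℝ → ℝ → ℝ) (u₀ : ℝ → ℝ)
    (I : Set ℝ) (u : ℝ → ℝ → ℝ) (g h : ℝ → ℝ) : Prop where
  g_reg : ContDiffOn ℝ 1 g I
  h_reg : ContDiffOn ℝ 1 h I
  g_lt_h : ∀ t ∈ I, g t < h t
  u_cont : ContinuousOn (fun p : ℝ × ℝ => u p.1 p.2)
      {p : ℝ × ℝ | p.1 ∈ I ∧ p.2 ∈ Icc (g p.1) (h p.1)}
  ux_cont : ContinuousOn (fun p : ℝ × ℝ => deriv (u p.1) p.2)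
      {p : ℝ × ℝ | p.1 ∈ I ∧ 0 < p.1 ∧ p.2 ∈ Icc (g p.1) (h p.1)}
  ut_diff : ∀ t ∈ I, 0 < t → ∀ x ∈ Ioo (g t) (h t),
      DifferentiableAt ℝ (fun s => u s x) t
  ux_diff : ∀ t ∈ I, 0 < t → ∀ x ∈ Icc (g t) (h t), DifferentiableAt ℝ (u t) x
  uxx_diff : ∀ t ∈ I, 0 < t → ∀ x ∈ Ioo (g t) (h t),
      DifferentiableAt ℝ (deriv (u t)) x
  ut_cont : ContinuousOn (fun p : ℝ × ℝ => deriv (fun s => u s p.2) p.1)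
      {p : ℝ × ℝ | p.1 ∈ I ∧ 0 < p.1 ∧ p.2 ∈ Ioo (g p.1) (h p.1)}
  uxx_cont : ContinuousOn (fun p : ℝ × ℝ => deriv (deriv (u p.1)) p.2)
      {p : ℝ × ℝ | p.1 ∈ I ∧ 0 < p.1 ∧ p.2 ∈ Ioo (g p.1) (h p.1)}
  pde : ∀ t ∈ I, 0 < t → ∀ x ∈ Ioo (g t) (h t),
      deriv (fun s => u s x) t = d * deriv (deriv (u t)) x + f t x (u t x)
  bc_g : ∀ t ∈ I, 0 < t → u t (g t) = δ
  bc_h : ∀ t ∈ I, 0 < t → u t (h t) = δ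
  stefan_g : ∀ t ∈ I, 0 < t → deriv g t = -(d / δ) * deriv (u t) (g t)
  stefan_h : ∀ t ∈ I, 0 < t → deriv h t = -(d / δ) * deriv (u t) (h t)
  g_init : g 0 = -h₀
  h_init : h 0 = h₀
  u_init : ∀ x ∈ Icc (-h₀) h₀, u 0 x = u₀ x

/-- A semi-wave pair `(c,q)` for `(f, δ, d)`. -/
def SemiWavePair (d δ : ℝ) (f : ℝ → ℝ) (c : ℝ) (q : ℝ → ℝ) : Prop :=
  0 < c ∧ ContDiffOn ℝ 2 q (Ici (0:ℝ)) ∧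
    (∀ z ∈ Ici (0:ℝ),
      d * derivWithin (derivWithin q (Ici (0:ℝ))) (Ici (0:ℝ)) z
        - c * derivWithin q (Ici (0:ℝ)) z + f (q z) = 0) ∧
    (∀ z ∈ Ioi (0:ℝ), 0 < q z) ∧ q 0 = δ ∧
    Tendsto q atTop (nhds 1) ∧
    derivWithin q (Ici (0:ℝ)) 0 = c * δ / d ∧
    ∀ z ∈ Ici (0:ℝ), 0 < derivWithin q (Ici (0:ℝ)) z

/-- Condition `(f2)` with Hölder exponent `β`. -/
def CondF2 (f : ℝ → ℝ → ℝ → ℝ) (β : ℝ) : Prop :=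
  β ∈ Ioo (0:ℝ) 1 ∧
    (∀ M > 0, ∃ C > 0, ∀ t₁ ∈ Ici (0:ℝ), ∀ t₂ ∈ Ici (0:ℝ), ∀ x₁ x₂ : ℝ,
        ∀ v ∈ Icc (0:ℝ) M,
        |f t₁ x₁ v - f t₂ x₂ v| ≤ C * (|t₁ - t₂| ^ (β / 2) + |x₁ - x₂| ^ β)) ∧
    (∀ t ∈ Ici (0:ℝ), ∀ x : ℝ, ContDiffOn ℝ 1 (f t x) (Ici (0:ℝ))) ∧
    (∀ t ∈ Ici (0:ℝ), ∀ x : ℝ, f t x 0 = 0) ∧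
    (∀ M > 0, ∃ L > 0, ∀ t ∈ Ici (0:ℝ), ∀ x : ℝ,
        ∀ v₁ ∈ Icc (0:ℝ) M, ∀ v₂ ∈ Icc (0:ℝ) M,
        |f t x v₁ - f t x v₂| ≤ L * |v₁ - v₂|)

/-- Condition `(f3)` with constant `M₀`. -/
def CondF3 (f : ℝ → ℝ → ℝ → ℝ) (M₀ : ℝ) : Prop :=
  0 < M₀ ∧ ∀ t ∈ Ici (0:ℝ), ∀ x : ℝ, ∀ v, M₀ ≤ v → f t x v < 0

/-- Part (i) of condition `(f4)`, with upper bound function `fbar`. -/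
def CondF4i (f : ℝ → ℝ → ℝ → ℝ) (fbar : ℝ → ℝ) (β : ℝ) : Prop :=
  CondF2 f β ∧ (∀ t ∈ Ici (0:ℝ), ∀ x : ℝ, f t x 1 = 0) ∧
    ContinuousOn fbar (Ici (1:ℝ)) ∧
    ∀ t ∈ Ici (0:ℝ), ∀ x : ℝ, ∀ v, 1 < v → f t x v ≤ fbar v ∧ fbar v < 0

/-- Condition `(f4)`, with bounds `fbar` (above, for `u > 1`) and
`funder` (below, of Allee type). -/
def CondF4 (f : ℝ → ℝ → ℝ → ℝ) (fbar funder : ℝ → ℝ) (θ β : ℝ) : Prop :=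
  CondF4i f fbar β ∧ AlleeType funder θ ∧
    ∀ t ∈ Ici (0:ℝ), ∀ x : ℝ, ∀ v, 0 ≤ v → funder v ≤ f t x v

/-- Combustion-type nonlinearity `(f_c)` with ignition value `θ`. -/
def CombustionType (f : ℝ → ℝ) (θ : ℝ) : Prop :=
  ContDiffOn ℝ 1 f (Ici (0:ℝ)) ∧ θ ∈ Ioo (0:ℝ) 1 ∧
    (∀ u ∈ Icc (0:ℝ) θ, f u = 0) ∧ f 1 = 0 ∧ derivWithin f (Ici (0:ℝ)) 1 < 0 ∧
    (∀ u ∈ Ioo θ (1:ℝ), 0 < f u) ∧ (∀ u ∈ Ioi (1:ℝ), f u < 0)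

/-- The (unnormalised) bistable condition `(F_b)` with constants `0 < P < Q`. -/
def CondFb (F : ℝ → ℝ) (P Q : ℝ) : Prop :=
  0 < P ∧ P < Q ∧ ContDiffOn ℝ 1 F (Ici (0:ℝ)) ∧
    F 0 = 0 ∧ F P = 0 ∧ F Q = 0 ∧
    derivWithin F (Ici (0:ℝ)) 0 < 0 ∧ derivWithin F (Ici (0:ℝ)) Q < 0 ∧
    (∀ u ∈ Ioo (0:ℝ) P, F u < 0) ∧ (∀ u ∈ Ioi Q, F u < 0) ∧
    (∀ u ∈ Ioo P Q, 0 < F u) ∧ 0 < ∫ s in (0:ℝ)..Q, F s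

/-- for an Allee-type `f` there is a unique `θ* ∈ [θ,1)` with
`∫₀^{θ*} f = 0` and `∫₀^{u} f > 0` for all `u ∈ (θ*,1]`. -/
theorem theta_star_exists_unique (f : ℝ → ℝ) (θ : ℝ) (hf : AlleeType f θ) :
    ∃! θs : ℝ, IsThetaStar f θ θs := by
  obtain ⟨hC, ⟨h0, h1⟩, -, -, -, -, -, hneg, hpos, -, hI⟩ := hf
  have hint : ∀ a b : ℝ, 0 ≤ a → 0 ≤ b → IntervalIntegrable f MeasureTheory.volume a b := by
    intro a b ha hb
    refine (hC.continuousOn.mono ?_).intervalIntegrable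
    intro x hx
    exact le_trans (le_min ha hb) hx.1
  have hmono : ∀ a b : ℝ, θ ≤ a → a < b → b ≤ 1 →
      (∫ s in (0:ℝ)..a, f s) < ∫ s in (0:ℝ)..b, f s := by
    intro a b ha hab hb
    have hp : 0 < ∫ s in a..b, f s :=
      intervalIntegral.intervalIntegral_pos_of_pos_on
        (hint a b (by linarith) (by linarith))
        (fun x hx => hpos x ⟨by linarith [hx.1], by linarith [hx.2]⟩) hab
    have := intervalIntegral.integral_add_adjacent_intervals
      (hint 0 a le_rfl (by linarith)) (hint a b (by linarith) (by linarith))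
    linarith
  have hθ : (∫ s in (0:ℝ)..θ, f s) ≤ 0 := by
    have := intervalIntegral.integral_mono_on h0 (hint 0 θ le_rfl h0)
      (intervalIntegrable_const (c := (0:ℝ))) hneg
    simpa using this
  have hcont : ContinuousOn (fun u => ∫ s in (0:ℝ)..u, f s) (Icc θ 1) := by
    have h := intervalIntegral.continuousOn_primitive_interval'
      (hint 0 1 le_rfl zero_le_one) (left_mem_uIcc)
    refine h.mono ?_
    rw [uIcc_of_le zero_le_one]
    exact Icc_subset_Icc_left h0
  obtain ⟨c, hc, hc0⟩ := intermediate_value_Icc h1.le hcont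
    (show (0:ℝ) ∈ Icc _ _ from ⟨hθ, hI.le⟩)
  simp only at hc0
  have hc1 : c < 1 := by
    rcases hc.2.lt_or_eq with h | h
    · exact h
    · rw [h] at hc0
      linarith
  refine ⟨c, ⟨⟨hc.1, hc1⟩, hc0, ?_⟩, ?_⟩
  · intro u hu
    have := hmono c u hc.1 hu.1 hu.2
    linarith
  · rintro y ⟨⟨hy, hy1⟩, hy0, -⟩
    rcases lt_trichotomy y c with h | h | h
    · have := hmono y c hy h hc.2
      linarith
    · exact h
    · have := hmono c y hc.1 h hy1.le
      linarith
end

section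
/- Suppose f is of Allee type (f_A) and δ ∈ (θ*_f, 1). Let (u,g,h) be a classical solution of the free boundary problem (a) with initial datum u₀ ∈ X(h₀) on [0,∞). Then g(t) → −∞ and h(t) → +∞ as t → ∞, and u(t,x) → 1 locally uniformly in x ∈ ℝ; that is, for every compact interval K ⊂ ℝ there is T_K > 0 with K ⊂ (g(t), h(t)) for all t ≥ T_K, and sup_{x ∈ K} |u(t,x) − 1| → 0 as t → ∞. -/
open Set Filter

namespace Spread

/-- Abstract first-touching argument on a compact moving domain. -/
lemma touch (a b : ℝ → ℝ) (v : ℝ → ℝ → ℝ) (t0 t1 : ℝ)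
    (ha : ContinuousOn a (Icc t0 t1)) (hb : ContinuousOn b (Icc t0 t1))
    (hv : ContinuousOn (fun q : ℝ × ℝ => v q.1 q.2)
      {q : ℝ × ℝ | q.1 ∈ Icc t0 t1 ∧ q.2 ∈ Icc (a q.1) (b q.1)})
    (h0 : ∀ x ∈ Icc (a t0) (b t0), 0 < v t0 x)
    (hlat : ∀ t ∈ Icc t0 t1, 0 < v t (a t) ∧ 0 < v t (b t))
    (hint : ∀ t ∈ Ioc t0 t1, ∀ x ∈ Ioo (a t) (b t), v t x = 0 →
      (∀ y ∈ Icc (a t) (b t), 0 ≤ v t y) →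
      (∀ s ∈ Ico t0 t, ∀ y ∈ Icc (a s) (b s), 0 < v s y) → False) :
    ∀ t ∈ Icc t0 t1, ∀ x ∈ Icc (a t) (b t), 0 < v t x := by
  set D := {q : ℝ × ℝ | q.1 ∈ Icc t0 t1 ∧ q.2 ∈ Icc (a q.1) (b q.1)} with hD
  obtain ⟨A, hA⟩ := (isCompact_Icc.image_of_continuousOn ha).bddBelow
  obtain ⟨B, hB⟩ := (isCompact_Icc.image_of_continuousOn hb).bddAbove
  have hDsub : D ⊆ Icc t0 t1 ×ˢ Icc A B := by
    rintro ⟨t, x⟩ ⟨ht, hx1, hx2⟩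
    exact ⟨ht, le_trans (hA ⟨t, ht, rfl⟩) hx1, le_trans hx2 (hB ⟨t, ht, rfl⟩)⟩
  have hDcl : IsClosed D := by
    have hC : IsClosed (Icc t0 t1 ×ˢ (univ : Set ℝ)) := isClosed_Icc.prod isClosed_univ
    have hfst : MapsTo Prod.fst (Icc t0 t1 ×ˢ (univ : Set ℝ)) (Icc t0 t1) := fun q hq => hq.1
    have c1 : ContinuousOn (fun q : ℝ × ℝ => q.2 - a q.1) (Icc t0 t1 ×ˢ (univ : Set ℝ)) :=
      continuousOn_snd.sub (ha.comp continuousOn_fst hfst)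
    have c2 : ContinuousOn (fun q : ℝ × ℝ => b q.1 - q.2) (Icc t0 t1 ×ˢ (univ : Set ℝ)) :=
      (hb.comp continuousOn_fst hfst).sub continuousOn_snd
    have e1 := c1.preimage_isClosed_of_isClosed hC (isClosed_Ici (a := (0:ℝ)))
    have e2 := c2.preimage_isClosed_of_isClosed hC (isClosed_Ici (a := (0:ℝ)))
    have : D = (Icc t0 t1 ×ˢ (univ : Set ℝ) ∩ (fun q : ℝ × ℝ => q.2 - a q.1) ⁻¹' Ici 0) ∩
        (Icc t0 t1 ×ˢ (univ : Set ℝ) ∩ (fun q : ℝ × ℝ => b q.1 - q.2) ⁻¹' Ici 0) := by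
      ext q
      simp only [hD, mem_ofPred_eq, mem_inter_iff, mem_prod, mem_univ, and_true, mem_preimage,
        mem_Ici, sub_nonneg, mem_Icc]
      tauto
    rw [this]
    exact e1.inter e2
  have hDc : IsCompact D :=
    (isCompact_Icc.prod isCompact_Icc).of_isClosed_subset hDcl hDsub
  set S := D ∩ (fun q : ℝ × ℝ => v q.1 q.2) ⁻¹' Iic 0 with hS
  have hScl : IsClosed S := hv.preimage_isClosed_of_isClosed hDcl isClosed_Iic
  have hSc : IsCompact S := hDc.of_isClosed_subset hScl inter_subset_left
  by_contra hcon
  push Not at hcon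
  obtain ⟨t, ht, x, hx, hvx⟩ := hcon
  have hne : S.Nonempty := ⟨(t, x), ⟨ht, hx⟩, hvx⟩
  obtain ⟨⟨ts, xs⟩, hqS, hmin⟩ := hSc.exists_isMinOn hne continuous_fst.continuousOn
  obtain ⟨⟨hts, hxs⟩, hvs⟩ := hqS
  simp only [mem_preimage, mem_Iic] at hts hxs hvs
  have hbefore : ∀ s ∈ Ico t0 ts, ∀ y ∈ Icc (a s) (b s), 0 < v s y := by
    intro s hs y hy
    by_contra hle
    have : (s, y) ∈ S := ⟨⟨⟨hs.1, hs.2.le.trans hts.2⟩, hy⟩, not_lt.1 hle⟩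
    have := hmin this
    simp only [mem_ofPred_eq] at this
    linarith [hs.2]
  have ht0 : t0 < ts := by
    rcases hts.1.eq_or_lt with h | h
    · subst h
      exact absurd (h0 xs hxs) (not_lt.2 hvs)
    · exact h
  have hnonneg : ∀ y ∈ Icc (a ts) (b ts), 0 ≤ v ts y := by
    intro y hy
    rcases hy.1.eq_or_lt with h | h
    · rw [← h]; exact (hlat ts hts).1.le
    rcases hy.2.eq_or_lt with h' | h'
    · rw [h']; exact (hlat ts hts).2.le
    have hIco : Ico t0 ts ∈ nhdsWithin ts (Iio ts) := Ico_mem_nhdsLT ht0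
    have hle : nhdsWithin ts (Iio ts) ≤ nhdsWithin ts (Icc t0 t1) :=
      le_trans (nhdsWithin_le_of_mem (s := Ico t0 ts) hIco)
        (nhdsWithin_mono _ fun s hs => ⟨hs.1, hs.2.le.trans hts.2⟩)
    have ea : ∀ᶠ s in nhdsWithin ts (Iio ts), a s < y :=
      ((ha ts hts).mono_left hle).eventually (gt_mem_nhds h)
    have eb : ∀ᶠ s in nhdsWithin ts (Iio ts), y < b s :=
      ((hb ts hts).mono_left hle).eventually (lt_mem_nhds h')
    have hmem : ∀ᶠ s in nhdsWithin ts (Iio ts), s ∈ Ico t0 ts ∧ y ∈ Icc (a s) (b s) := by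
      filter_upwards [ea, eb, hIco] with s h1 h2 h3
      exact ⟨h3, h1.le, h2.le⟩
    have hcv : Tendsto (fun s => v s y) (nhdsWithin ts (Iio ts)) (nhds (v ts y)) := by
      have := hv (ts, y) ⟨hts, hy⟩
      refine Tendsto.comp (f := fun s => (s, y)) (g := fun q : ℝ × ℝ => v q.1 q.2) this ?_
      refine tendsto_nhdsWithin_iff.2 ⟨?_, ?_⟩
      · exact ((continuous_id.prodMk continuous_const).tendsto ts).mono_left nhdsWithin_le_nhds
      · filter_upwards [hmem] with s hs
        exact ⟨⟨hs.1.1, hs.1.2.le.trans hts.2⟩, hs.2⟩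
    refine ge_of_tendsto hcv ?_
    filter_upwards [hmem] with s hs
    exact (hbefore s hs.1 y hs.2).le
  have hz : v ts xs = 0 := le_antisymm hvs (hnonneg xs hxs)
  have hl : a ts < xs := by
    rcases hxs.1.eq_or_lt with h | h
    · have := (hlat ts hts).1; rw [h] at this; linarith
    · exact h
  have hr : xs < b ts := by
    rcases hxs.2.eq_or_lt with h | h
    · have := (hlat ts hts).2; rw [← h] at this; linarith
    · exact h
  exact hint ts ⟨ht0, hts.2⟩ xs ⟨hl, hr⟩ hz hnonneg hbefore

lemma second_deriv_nonneg {φ φ' : ℝ → ℝ} {x c : ℝ}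
    (h1 : ∀ᶠ y in nhds x, HasDerivAt φ (φ' y) y) (h2 : HasDerivAt φ' c x)
    (hmin : IsLocalMin φ x) : 0 ≤ c := by
  by_contra hc
  push Not at hc
  have hd : deriv φ =ᶠ[nhds x] φ' := h1.mono fun y hy => hy.deriv
  have hd2 : deriv (deriv φ) x = c := by
    rw [hd.deriv_eq]; exact h2.deriv
  have h0 : deriv φ x = 0 := hmin.deriv_eq_zero
  have hmax : IsLocalMax φ x := by
    apply isLocalMax_of_deriv_deriv_neg
    · rw [hd2]; exact hc
    · exact h0
    · exact h1.self_of_nhds.continuousAt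
  have hconst : φ =ᶠ[nhds x] fun _ => φ x := by
    filter_upwards [hmin, hmax] with y hy hy'
    exact le_antisymm hy' hy
  have hd0 : deriv φ =ᶠ[nhds x] fun _ => 0 := by
    have := hconst.deriv
    simpa using this
  have : deriv (deriv φ) x = 0 := by
    rw [hd0.deriv_eq]; simp
  linarith

lemma time_deriv_nonpos {φ : ℝ → ℝ} {t c : ℝ} (h : HasDerivAt φ c t) (h0 : φ t = 0)
    (hs : ∀ᶠ s in nhdsWithin t (Iio t), 0 ≤ φ s) : c ≤ 0 := by
  have := (hasDerivAt_iff_tendsto_slope.1 h).mono_left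
    (nhdsWithin_mono t (fun s (hs : s ∈ Iio t) => ne_of_lt hs))
  refine le_of_tendsto this ?_
  filter_upwards [hs, self_mem_nhdsWithin] with s h1 h2
  rw [slope_def_field, h0, sub_zero]
  exact div_nonpos_of_nonneg_of_nonpos h1 (by simpa using (le_of_lt h2))

/-- Comparison with a strict sub/super solution (`σ = 1` / `σ = -1`). -/
lemma comp {d δ h₀ : ℝ} {f u₀ : ℝ → ℝ} {u : ℝ → ℝ → ℝ} {g h : ℝ → ℝ} (hd : 0 < d)
    (hsol : ClassicalSolution d δ h₀ (fun _ _ v => f v) u₀ (Ici (0:ℝ)) u g h)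
    (σ : ℝ) (a b : ℝ → ℝ) (w : ℝ → ℝ → ℝ) (t0 t1 : ℝ) (ht0 : 0 ≤ t0)
    (ha : ContinuousOn a (Icc t0 t1)) (hb : ContinuousOn b (Icc t0 t1))
    (hga : ∀ t ∈ Icc t0 t1, g t ≤ a t) (hbh : ∀ t ∈ Icc t0 t1, b t ≤ h t)
    (hw : ContinuousOn (fun q : ℝ × ℝ => w q.1 q.2)
      {q : ℝ × ℝ | q.1 ∈ Icc t0 t1 ∧ q.2 ∈ Icc (a q.1) (b q.1)})
    (h0 : ∀ x ∈ Icc (a t0) (b t0), 0 < σ * (u t0 x - w t0 x))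
    (hlat : ∀ t ∈ Icc t0 t1, 0 < σ * (u t (a t) - w t (a t)) ∧ 0 < σ * (u t (b t) - w t (b t)))
    (hint : ∀ t ∈ Ioc t0 t1, ∀ x ∈ Ioo (a t) (b t), u t x = w t x →
      ∃ (wt wxx : ℝ) (wx : ℝ → ℝ), HasDerivAt (fun s => w s x) wt t ∧
        (∀ᶠ y in nhds x, HasDerivAt (w t) (wx y) y) ∧ HasDerivAt wx wxx x ∧
        0 < σ * (d * wxx + f (w t x) - wt)) :
    ∀ t ∈ Icc t0 t1, ∀ x ∈ Icc (a t) (b t), 0 < σ * (u t x - w t x) := by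
  by_cases hσ : σ = 0
  · subst hσ
    intro t ht x hx
    exfalso
    have := (hlat t ht).1
    simp at this
  refine touch a b (fun t x => σ * (u t x - w t x)) t0 t1 ha hb ?_ h0 hlat ?_
  · refine continuousOn_const.mul ((hsol.u_cont.mono ?_).sub hw)
    rintro ⟨t, x⟩ ⟨ht, hx⟩
    exact ⟨ht0.trans ht.1, (hga t ht).trans hx.1, hx.2.trans (hbh t ht)⟩
  · intro t ht x hx hz hnn hbef
    have htI : t ∈ Icc t0 t1 := ⟨ht.1.le, ht.2⟩
    have htp : 0 < t := lt_of_le_of_lt ht0 ht.1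
    have hti : t ∈ Ici (0:ℝ) := htp.le
    have huw : u t x = w t x := by
      have : u t x - w t x = 0 := (mul_eq_zero.1 hz).resolve_left hσ
      linarith
    obtain ⟨wt, wxx, wx, hwt, hwx, hwxx, hpos⟩ := hint t ht x hx huw
    have hxI : ∀ y ∈ Ioo (a t) (b t), y ∈ Ioo (g t) (h t) := fun y hy =>
      ⟨(hga t htI).trans_lt hy.1, hy.2.trans_le (hbh t htI)⟩
    have hnhds : Ioo (a t) (b t) ∈ nhds x := Ioo_mem_nhds hx.1 hx.2
    have hxx : 0 ≤ σ * (deriv (deriv (u t)) x - wxx) := by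
      refine second_deriv_nonneg (φ := fun y => σ * (u t y - w t y))
        (φ' := fun y => σ * (deriv (u t) y - wx y)) (x := x) ?_ ?_ ?_
      · filter_upwards [hwx, hnhds] with y h1 h2
        have := (hsol.ux_diff t hti htp y (Ioo_subset_Icc_self (hxI y h2))).hasDerivAt
        exact (this.sub h1).const_mul σ
      · exact (((hsol.uxx_diff t hti htp x (hxI x hx)).hasDerivAt).sub hwxx).const_mul σ
      · filter_upwards [hnhds] with y hy
        have := hnn y (Ioo_subset_Icc_self hy)
        change σ * (u t x - w t x) ≤ σ * (u t y - w t y)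
        have hz' : σ * (u t x - w t x) = 0 := hz
        have this' : 0 ≤ σ * (u t y - w t y) := this
        linarith
    have htt : σ * (deriv (fun s => u s x) t - wt) ≤ 0 := by
      refine time_deriv_nonpos (φ := fun s => σ * (u s x - w s x)) (t := t) ?_ hz ?_
      · exact (((hsol.ut_diff t hti htp x (hxI x hx)).hasDerivAt).sub hwt).const_mul σ
      · have hIco : Ico t0 t ∈ nhdsWithin t (Iio t) := Ico_mem_nhdsLT ht.1
        have hle : nhdsWithin t (Iio t) ≤ nhdsWithin t (Icc t0 t1) :=
          le_trans (nhdsWithin_le_of_mem (s := Ico t0 t) hIco)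
            (nhdsWithin_mono _ fun s hs => ⟨hs.1, hs.2.le.trans ht.2⟩)
        have ea : ∀ᶠ s in nhdsWithin t (Iio t), a s < x :=
          ((ha t htI).mono_left hle).eventually (gt_mem_nhds hx.1)
        have eb : ∀ᶠ s in nhdsWithin t (Iio t), x < b s :=
          ((hb t htI).mono_left hle).eventually (lt_mem_nhds hx.2)
        filter_upwards [ea, eb, hIco] with s h1 h2 h3
        exact (hbef s h3 x ⟨h1.le, h2.le⟩).le
    have hp := hsol.pde t hti htp x (hxI x hx)
    simp only [huw] at hp
    rw [hp] at htt
    have : 0 ≤ d * (σ * (deriv (deriv (u t)) x - wxx)) := mul_nonneg hd.le hxx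
    nlinarith

section
variable {d δ h₀ : ℝ} {f u₀ : ℝ → ℝ} {u : ℝ → ℝ → ℝ} {g h : ℝ → ℝ}

lemma bc (hu₀ : InX δ h₀ u₀) (hh₀ : 0 < h₀)
    (hsol : ClassicalSolution d δ h₀ (fun _ _ v => f v) u₀ (Ici (0:ℝ)) u g h)
    (t : ℝ) (ht : 0 ≤ t) : u t (g t) = δ ∧ u t (h t) = δ := by
  rcases ht.eq_or_lt with h0 | h0
  · subst h0
    rw [hsol.g_init, hsol.h_init, hsol.u_init _ ⟨le_rfl, by linarith⟩,
      hsol.u_init _ ⟨by linarith, le_rfl⟩]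
    exact ⟨hu₀.2.1, hu₀.2.2.1⟩
  · exact ⟨hsol.bc_g t ht h0, hsol.bc_h t ht h0⟩

/-- Comparison with functions of time only. -/
lemma compt (hd : 0 < d) (hu₀ : InX δ h₀ u₀) (hh₀ : 0 < h₀)
    (hsol : ClassicalSolution d δ h₀ (fun _ _ v => f v) u₀ (Ici (0:ℝ)) u g h)
    (σ : ℝ) (w w' : ℝ → ℝ) (t0 t1 : ℝ) (ht0 : 0 ≤ t0)
    (hw : ∀ t, HasDerivAt w (w' t) t)
    (h0 : ∀ x ∈ Icc (g t0) (h t0), 0 < σ * (u t0 x - w t0))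
    (hlat : ∀ t ∈ Icc t0 t1, 0 < σ * (δ - w t))
    (hint : ∀ t ∈ Ioc t0 t1, 0 < σ * (f (w t) - w' t)) :
    ∀ t ∈ Icc t0 t1, ∀ x ∈ Icc (g t) (h t), 0 < σ * (u t x - w t) := by
  have hsub : Icc t0 t1 ⊆ Ici (0:ℝ) := fun t ht => ht0.trans ht.1
  have hwc : Continuous w := continuous_iff_continuousAt.2 fun t => (hw t).continuousAt
  refine comp hd hsol σ g h (fun t _ => w t) t0 t1 ht0 (hsol.g_reg.continuousOn.mono hsub)
    (hsol.h_reg.continuousOn.mono hsub) (fun _ _ => le_rfl) (fun _ _ => le_rfl)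
    (hwc.comp continuous_fst).continuousOn h0 ?_ ?_
  · intro t ht
    obtain ⟨h1, h2⟩ := bc hu₀ hh₀ hsol t (hsub ht)
    rw [h1, h2]
    exact ⟨hlat t ht, hlat t ht⟩
  · intro t ht x hx _
    refine ⟨w' t, 0, fun _ => 0, hw t, ?_, hasDerivAt_const _ _, ?_⟩
    · exact Eventually.of_forall fun y => hasDerivAt_const _ _
    · have := hint t ht
      simpa using this

lemma u0_cont (hu₀ : InX δ h₀ u₀) : ContinuousOn u₀ (Icc (-h₀) h₀) := hu₀.1.continuousOn

lemma pos (hd : 0 < d) (hu₀ : InX δ h₀ u₀) (hh₀ : 0 < h₀)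
    (hsol : ClassicalSolution d δ h₀ (fun _ _ v => f v) u₀ (Ici (0:ℝ)) u g h)
    (hδ0 : 0 < δ) (hδ1 : δ < 1) {K : ℝ} (hK : 0 ≤ K) (hf : ∀ v ∈ Icc (0:ℝ) 1, -K * v ≤ f v) :
    ∀ t ≥ 0, ∀ x ∈ Icc (g t) (h t), 0 < u t x := by
  obtain ⟨xm, hxm, hmin⟩ := isCompact_Icc.exists_isMinOn
    (⟨0, by linarith, hh₀.le⟩ : (Icc (-h₀) h₀).Nonempty) (u0_cont hu₀)
  have hm := hu₀.2.2.2 xm hxm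
  set m := min (u₀ xm) δ / 2 with hmdef
  have hmp : 0 < m := by have := lt_min hm hδ0; positivity
  have hm1 : m < u₀ xm := by
    have := min_le_left (u₀ xm) δ; linarith
  have hm2 : m < δ := by
    have := min_le_right (u₀ xm) δ; linarith
  intro t ht x hx
  have hexp : ∀ s : ℝ, 0 ≤ s → m * Real.exp (-(K + 1) * s) ≤ m := by
    intro s hs
    have : Real.exp (-(K + 1) * s) ≤ 1 := Real.exp_le_one_iff.2 (by nlinarith)
    nlinarith
  have hexp0 : ∀ s : ℝ, 0 < m * Real.exp (-(K + 1) * s) := fun s => by positivity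
  have := compt hd hu₀ hh₀ hsol 1 (fun s => m * Real.exp (-(K + 1) * s))
    (fun s => -(K + 1) * (m * Real.exp (-(K + 1) * s))) 0 t le_rfl ?_ ?_ ?_ ?_ t ⟨ht, le_rfl⟩ x hx
  · have h2 := hexp0 t
    simp only [one_mul] at this
    linarith
  · intro s
    have h1 : HasDerivAt (fun s : ℝ => -(K + 1) * s) (-(K + 1)) s := by
      simpa using (hasDerivAt_id s).const_mul (-(K + 1))
    exact ((h1.exp).const_mul m).congr_deriv (by ring)
  · intro x hx
    rw [hsol.g_init, hsol.h_init] at hx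
    rw [hsol.u_init x hx]
    have := hmin hx
    simp only [mem_ofPred_eq] at this
    simp
    linarith
  · intro s hs
    have := hexp s hs.1
    simp only [one_mul]
    linarith
  · intro s hs
    have h1 := hexp s hs.1.le
    have h2 := hexp0 s
    have := hf _ ⟨h2.le, by linarith⟩
    simp only [one_mul]
    linarith

/-- Upper bound: eventually `u < 1 + ε`. -/
lemma upper (hd : 0 < d) (hu₀ : InX δ h₀ u₀) (hh₀ : 0 < h₀)
    (hsol : ClassicalSolution d δ h₀ (fun _ _ v => f v) u₀ (Ici (0:ℝ)) u g h)
    (hδ1 : δ < 1) (hfc : ContinuousOn f (Ici 0)) (hf1 : ∀ v ∈ Ioi (1:ℝ), f v < 0)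
    (ε : ℝ) (hε : 0 < ε) :
    ∃ T > 0, ∀ t ≥ T, ∀ x ∈ Icc (g t) (h t), u t x < 1 + ε := by
  obtain ⟨xm, hxm, hmax⟩ := isCompact_Icc.exists_isMaxOn
    (⟨0, by linarith, hh₀.le⟩ : (Icc (-h₀) h₀).Nonempty) (u0_cont hu₀)
  set M := max (u₀ xm) (1 + ε) + 1 with hM
  have hM1 : u₀ xm < M := by have := le_max_left (u₀ xm) (1 + ε); linarith
  have hM2 : 1 + ε < M := by have := le_max_right (u₀ xm) (1 + ε); linarith
  have huM : ∀ t ≥ 0, ∀ x ∈ Icc (g t) (h t), u t x < M := by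
    intro t ht x hx
    have := compt hd hu₀ hh₀ hsol (-1) (fun _ => M) (fun _ => 0) 0 t le_rfl
      (fun s => hasDerivAt_const _ _) ?_ ?_ ?_ t ⟨ht, le_rfl⟩ x hx
    · linarith
    · intro x hx
      rw [hsol.g_init, hsol.h_init] at hx
      rw [hsol.u_init x hx]
      have := hmax hx
      simp only [mem_ofPred_eq] at this
      linarith
    · intro s hs
      linarith
    · intro s hs
      have := hf1 M (by simp only [mem_Ioi]; linarith)
      linarith
  obtain ⟨vm, hvm, hvmax⟩ := isCompact_Icc.exists_isMaxOn
    (⟨M, by linarith, le_rfl⟩ : (Icc (1 + ε) M).Nonempty)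
    (hfc.mono fun v hv => by have := hv.1; simp only [mem_Ici]; linarith)
  have hη := hf1 vm (by have := hvm.1; simp only [mem_Ioi]; linarith)
  set η := -f vm / 2 with hηd
  have hηp : 0 < η := by linarith
  refine ⟨(M - (1 + ε)) / η, div_pos (by linarith) hηp, ?_⟩
  intro t ht x hx
  set τ := (M - (1 + ε)) / η with hτ
  have hτη : η * τ = M - (1 + ε) := by rw [hτ]; field_simp
  have hτ0 : 0 < τ := div_pos (by linarith) hηp
  have := compt hd hu₀ hh₀ hsol (-1) (fun s => M - η * (s - (t - τ))) (fun _ => -η) (t - τ) t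
      (by linarith) ?_ ?_ ?_ ?_ t ⟨by linarith, le_rfl⟩ x hx
  · simp only [sub_sub_cancel, hτη] at this
    linarith
  · intro s
    have h1 : HasDerivAt (fun s : ℝ => s - (t - τ)) 1 s := (hasDerivAt_id s).sub_const _
    simpa using (h1.const_mul η).const_sub M
  · intro y hy
    have := huM (t - τ) (by linarith) y hy
    simp only [sub_self]
    linarith
  · intro s hs
    have : η * (s - (t - τ)) ≤ η * τ := mul_le_mul_of_nonneg_left (by linarith [hs.2]) hηp.le
    linarith
  · intro s hs
    have h1 : η * (s - (t - τ)) ≤ η * τ := mul_le_mul_of_nonneg_left (by linarith [hs.2]) hηp.le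
    have h2 : 0 ≤ η * (s - (t - τ)) := mul_nonneg hηp.le (by linarith [hs.1])
    have := hvmax (show M - η * (s - (t - τ)) ∈ Icc (1 + ε) M from ⟨by linarith, by linarith⟩)
    simp only [mem_ofPred_eq] at this
    linarith

/-- If `u > p` eventually, with `f > 0` on `[p, δ]`, then `u ≥ δ` eventually. -/
lemma lift (hd : 0 < d) (hu₀ : InX δ h₀ u₀) (hh₀ : 0 < h₀)
    (hsol : ClassicalSolution d δ h₀ (fun _ _ v => f v) u₀ (Ici (0:ℝ)) u g h)
    {p : ℝ} (hp0 : 0 < p) (hpδ : p < δ) (hfc : ContinuousOn f (Ici 0))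
    (hfp : ∀ v ∈ Icc p δ, 0 < f v) {T : ℝ} (hT : 0 ≤ T)
    (hup : ∀ t ≥ T, ∀ x ∈ Icc (g t) (h t), p < u t x) :
    ∃ T' > 0, ∀ t ≥ T', ∀ x ∈ Icc (g t) (h t), δ ≤ u t x := by
  obtain ⟨vm, hvm, hvmin⟩ := isCompact_Icc.exists_isMinOn
    (⟨p, le_rfl, hpδ.le⟩ : (Icc p δ).Nonempty)
    (hfc.mono fun v hv => by have := hv.1; simp only [mem_Ici]; linarith)
  have hη := hfp vm hvm
  set η := f vm / 2 with hηd
  have hηp : 0 < η := by linarith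
  refine ⟨T + (δ - p) / η, add_pos_of_nonneg_of_pos hT (div_pos (by linarith) hηp), ?_⟩
  intro t ht x hx
  refine le_of_forall_lt fun q hq => ?_
  by_cases hqp : q ≤ p
  · refine lt_of_le_of_lt hqp (hup t ?_ x hx)
    have : 0 < (δ - p) / η := div_pos (by linarith) hηp
    linarith
  push Not at hqp
  set τ := (q - p) / η with hτ
  have hτη : η * τ = q - p := by rw [hτ]; field_simp
  have hτ0 : 0 < τ := div_pos (by linarith) hηp
  have hτ1 : τ ≤ (δ - p) / η := by rw [hτ]; gcongr
  have := compt hd hu₀ hh₀ hsol 1 (fun s => p + η * (s - (t - τ))) (fun _ => η) (t - τ) t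
      (by linarith) ?_ ?_ ?_ ?_ t ⟨by linarith, le_rfl⟩ x hx
  · simp only [sub_sub_cancel, hτη] at this
    linarith
  · intro s
    have h1 : HasDerivAt (fun s : ℝ => s - (t - τ)) 1 s := (hasDerivAt_id s).sub_const _
    simpa using (h1.const_mul η).const_add p
  · intro y hy
    have := hup (t - τ) (by linarith) y hy
    simp only [sub_self]
    linarith
  · intro s hs
    have : η * (s - (t - τ)) ≤ η * τ := mul_le_mul_of_nonneg_left (by linarith [hs.2]) hηp.le
    linarith
  · intro s hs
    have h1 : η * (s - (t - τ)) ≤ η * τ := mul_le_mul_of_nonneg_left (by linarith [hs.2]) hηp.le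
    have h2 : 0 ≤ η * (s - (t - τ)) := mul_nonneg hηp.le (by linarith [hs.1])
    have := hvmin (show p + η * (s - (t - τ)) ∈ Icc p δ from ⟨by linarith, by linarith⟩)
    simp only [mem_ofPred_eq] at this
    linarith

lemma bump {d p : ℝ} (hd : 0 < d) (hp : 0 < p) {f : ℝ → ℝ} (hfc : ContinuousOn f (Ici 0))
    (hfp : 0 < f p) (hF : ∀ s ∈ Ico 0 p, 0 < ∫ r in s..p, f r) :
    ∃ (V V' : ℝ → ℝ) (η B L : ℝ), 0 < η ∧ 0 ≤ B ∧ 0 < L ∧ V 0 = p ∧ (∀ z, V z ≤ p) ∧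
      (∀ z, HasDerivAt V (V' z) z) ∧
      (∀ z, 0 < V z → |V' z| ≤ B ∧ HasDerivAt V' ((η - f (V z)) / d) z) ∧
      ∀ z, L ≤ |z| → V z ≤ 0 := by
  set ft : ℝ → ℝ := fun s => f (max s 0) with hft
  have hftc : Continuous ft := by
    refine hfc.comp_continuous (continuous_id.max continuous_const) fun s => ?_
    simp
  have hfte : ∀ s, 0 ≤ s → ft s = f s := fun s hs => by simp [hft, hs]
  set F : ℝ → ℝ := fun s => ∫ r in (0:ℝ)..s, ft r with hFd
  have hFder : ∀ s, HasDerivAt F (ft s) s := fun s =>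
    intervalIntegral.integral_hasDerivAt_right (hftc.intervalIntegrable _ _)
      (hftc.stronglyMeasurableAtFilter _ _) hftc.continuousAt
  have hFlt : ∀ s ∈ Ico 0 p, F s < F p := by
    intro s hs
    have h1 := hF s hs
    have h2 : ∫ r in s..p, f r = ∫ r in s..p, ft r := by
      apply intervalIntegral.integral_congr
      intro r hr
      rw [uIcc_of_le hs.2.le] at hr
      exact (hfte r (hs.1.trans hr.1)).symm
    have h3 : F p - F s = ∫ r in s..p, ft r :=
      intervalIntegral.integral_interval_sub_left (hftc.intervalIntegrable _ _)
        (hftc.intervalIntegrable _ _)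
    linarith
  set ρ := dslope F p with hρ
  have hρc : Continuous ρ := by
    have hFc : Continuous F := continuous_iff_continuousAt.2 fun s => (hFder s).continuousAt
    refine continuous_iff_continuousAt.2 fun s => ?_
    by_cases hs : s = p
    · rw [hs]; exact continuousAt_dslope_same.2 (hFder p).differentiableAt
    · exact (continuousAt_dslope_of_ne hs).2 hFc.continuousAt
  have hρeq : ∀ s, (p - s) * ρ s = F p - F s := by
    intro s
    have := sub_smul_dslope F p s
    simp only [smul_eq_mul] at this
    rw [hρ]
    linarith
  have hρp : ρ p = f p := by
    rw [hρ, dslope_same, (hFder p).deriv, hfte p hp.le]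
  have hρpos : ∀ s ∈ Icc 0 p, 0 < ρ s := by
    intro s hs
    rcases hs.2.eq_or_lt with h | h
    · rw [h, hρp]; exact hfp
    · have h1 := hρeq s
      have h2 := hFlt s ⟨hs.1, h⟩
      by_contra hc
      nlinarith
  obtain ⟨sm, hsm, hmin⟩ := isCompact_Icc.exists_isMinOn
    (⟨p, hp.le, le_rfl⟩ : (Icc 0 p).Nonempty) hρc.continuousOn
  obtain ⟨sM, hsM, hmax⟩ := isCompact_Icc.exists_isMaxOn
    (⟨p, hp.le, le_rfl⟩ : (Icc 0 p).Nonempty) hρc.continuousOn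
  set η := ρ sm / 2 with hη
  have hηp : 0 < η := by have := hρpos sm hsm; positivity
  have hlow : ∀ s ∈ Icc 0 p, 2 * η ≤ ρ s := by
    intro s hs
    have := hmin hs
    simp only [mem_ofPred_eq] at this
    linarith
  have hupp : ∀ s ∈ Icc 0 p, ρ s ≤ ρ sM := fun s hs => hmax hs
  have hclamp : ∀ y : ℝ, max 0 (p - y ^ 2) ∈ Icc 0 p := fun y =>
    ⟨le_max_left _ _, max_le hp.le (by nlinarith [sq_nonneg y])⟩
  set r : ℝ → ℝ := fun y => Real.sqrt ((ρ (max 0 (p - y ^ 2)) - η) / (2 * d)) with hr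
  have hrc : Continuous r := by
    refine Real.continuous_sqrt.comp ?_
    refine Continuous.div_const ?_ _
    exact (hρc.comp (by fun_prop)).sub continuous_const
  have hrsq : ∀ y, r y ^ 2 = (ρ (max 0 (p - y ^ 2)) - η) / (2 * d) := by
    intro y
    refine Real.sq_sqrt ?_
    have := hlow _ (hclamp y)
    exact div_nonneg (by linarith) (by positivity)
  set c0 := Real.sqrt (η / (2 * d)) with hc0
  have hc0p : 0 < c0 := Real.sqrt_pos.2 (by positivity)
  set C := Real.sqrt ((ρ sM - η) / (2 * d)) with hC
  have hrlow : ∀ y, c0 ≤ r y := by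
    intro y
    apply Real.sqrt_le_sqrt
    have := hlow _ (hclamp y)
    gcongr
    linarith
  have hrup : ∀ y, r y ≤ C := by
    intro y
    apply Real.sqrt_le_sqrt
    have := hupp _ (hclamp y)
    gcongr
  have hrp : ∀ y, 0 < r y := fun y => hc0p.trans_le (hrlow y)
  have hCp : 0 < C := (hrp 0).trans_le (hrup 0)
  have hic : Continuous fun y => (r y)⁻¹ := hrc.inv₀ fun y => (hrp y).ne'
  set K : ℝ → ℝ := fun y => ∫ s in (0:ℝ)..y, (r s)⁻¹ with hK
  have hKder : ∀ y, HasDerivAt K ((r y)⁻¹) y := fun y =>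
    intervalIntegral.integral_hasDerivAt_right (hic.intervalIntegrable _ _)
      (hic.stronglyMeasurableAtFilter _ _) hic.continuousAt
  have hK0 : K 0 = 0 := by simp [hK]
  have hKc : Continuous K := continuous_iff_continuousAt.2 fun s => (hKder s).continuousAt
  have hKm : StrictMono K := strictMono_of_deriv_pos fun y => by
    rw [(hKder y).deriv]; exact inv_pos.2 (hrp y)
  have hm1 : Monotone fun y => K y - C⁻¹ * y := by
    have hder : ∀ y, HasDerivAt (fun y => K y - C⁻¹ * y) ((r y)⁻¹ - C⁻¹ * 1) y := fun y =>
      (hKder y).sub ((hasDerivAt_id y).const_mul C⁻¹)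
    refine monotone_of_deriv_nonneg (fun y => (hder y).differentiableAt) fun y => ?_
    rw [(hder y).deriv]
    have := inv_anti₀ (hrp y) (hrup y)
    linarith
  have hm2 : Monotone fun y => c0⁻¹ * y - K y := by
    have hder : ∀ y, HasDerivAt (fun y => c0⁻¹ * y - K y) (c0⁻¹ * 1 - (r y)⁻¹) y := fun y =>
      ((hasDerivAt_id y).const_mul c0⁻¹).sub (hKder y)
    refine monotone_of_deriv_nonneg (fun y => (hder y).differentiableAt) fun y => ?_
    rw [(hder y).deriv]
    have := inv_anti₀ hc0p (hrlow y)
    linarith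
  have hsurj : Function.Surjective K := by
    refine hKc.surjective ?_ ?_
    · refine tendsto_atTop_mono' _ (f₁ := fun y => C⁻¹ * y) ?_
        (tendsto_id.const_mul_atTop (inv_pos.2 hCp))
      filter_upwards [eventually_ge_atTop 0] with y hy
      have := hm1 hy
      simp only [hK0] at this
      linarith
    · refine tendsto_atBot_mono' _ (f₁ := fun y => C⁻¹ * y) ?_
        (tendsto_id.const_mul_atBot (inv_pos.2 hCp))
      filter_upwards [eventually_le_atBot 0] with y hy
      have := hm1 hy
      simp only [hK0] at this
      linarith
  set e := hKm.orderIsoOfSurjective K hsurj with he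
  set Y : ℝ → ℝ := fun z => e.symm z with hY
  have hYc : Continuous Y := e.symm.continuous
  have hKY : ∀ z, K (Y z) = z := fun z => e.apply_symm_apply z
  have hYder : ∀ z, HasDerivAt Y (r (Y z)) z := by
    intro z
    have := HasDerivAt.of_local_left_inverse (f := K) (g := Y) (a := z) hYc.continuousAt
      (hKder (Y z)) (inv_ne_zero (hrp _).ne') (Eventually.of_forall hKY)
    simpa using this
  have hY0 : Y 0 = 0 := hKm.injective (by rw [hKY, hK0])
  have hYz : ∀ z, Y z = 0 → z = 0 := fun z hz => by rw [← hKY z, hz, hK0]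
  have hYL : ∀ z, c0 * |z| ≤ |Y z| := by
    intro z
    rcases le_total 0 (Y z) with h | h
    · have h1 := hm2 h
      have h2 := hKm.monotone h
      simp only [hK0, hKY] at h1 h2
      rw [abs_of_nonneg h, abs_of_nonneg h2]
      have : z ≤ c0⁻¹ * Y z := by linarith
      calc c0 * z ≤ c0 * (c0⁻¹ * Y z) := by gcongr
        _ = Y z := by field_simp
    · have h1 := hm2 h
      have h2 := hKm.monotone h
      simp only [hK0, hKY] at h1 h2
      rw [abs_of_nonpos h, abs_of_nonpos h2]
      have : -z ≤ c0⁻¹ * (-Y z) := by linarith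
      calc c0 * -z ≤ c0 * (c0⁻¹ * -Y z) := by gcongr
        _ = -Y z := by field_simp
  set V : ℝ → ℝ := fun z => p - Y z ^ 2 with hV
  set V' : ℝ → ℝ := fun z => -2 * (Y z * r (Y z)) with hV'
  have hVder : ∀ z, HasDerivAt V (V' z) z := by
    intro z
    refine (((hYder z).pow 2).const_sub p).congr_deriv ?_
    simp only [hV']
    ring
  have hVc : Continuous V := continuous_iff_continuousAt.2 fun s => (hVder s).continuousAt
  have hV'c : Continuous V' := continuous_const.mul (hYc.mul (hrc.comp hYc))
  refine ⟨V, V', η, 2 * (Real.sqrt p * C), Real.sqrt p / c0, hηp, by positivity, by positivity,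
    by simp [hV, hY0], fun z => by simp only [hV]; nlinarith [sq_nonneg (Y z)], hVder, ?_, ?_⟩
  · intro z hz
    constructor
    · have h1 : |Y z| ≤ Real.sqrt p := by
        apply Real.abs_le_sqrt
        simp only [hV] at hz
        linarith
      simp only [hV', abs_mul, abs_neg, abs_two, abs_of_pos (hrp (Y z))]
      have := hrup (Y z)
      have := hrp (Y z)
      gcongr
    · by_cases hz0 : Y z = 0
      · have hzz := hYz z hz0
        subst hzz
        have hsl := (hasDerivAt_iff_tendsto_slope.1 (hYder 0))
        have hrt : Tendsto (fun z => r (Y z)) (nhdsWithin 0 {0}ᶜ) (nhds (r (Y 0))) :=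
          ((hrc.comp hYc).tendsto 0).mono_left nhdsWithin_le_nhds
        have hlim := (hsl.mul hrt).const_mul (-2)
        rw [hasDerivAt_iff_tendsto_slope]
        have hval : -2 * (r (Y 0) * r (Y 0)) = (η - f (V 0)) / d := by
          have h1 := hrsq (Y 0)
          rw [hY0] at h1 ⊢
          have h2 : max 0 (p - (0:ℝ) ^ 2) = p := by simp [hp.le]
          rw [h2, hρp] at h1
          have : V 0 = p := by simp [hV, hY0]
          rw [this, ← sq, h1]
          field_simp
          ring
        rw [← hval]
        refine hlim.congr fun y => ?_
        simp only [slope_def_field, hV', hY0]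
        ring
      · have hV'z : V' z ≠ 0 := by
          simp only [hV']
          have := (hrp (Y z)).ne'
          simp [hz0, this]
        set E : ℝ → ℝ := fun y => 2 / d * (F p - F (V y) - η * (p - V y)) with hE
        have hEq : ∀ᶠ y in nhds z, V' y ^ 2 = E y := by
          filter_upwards [hVc.continuousAt.eventually (lt_mem_nhds hz)] with y hy
          have h1 := hrsq (Y y)
          have h2 : max 0 (p - Y y ^ 2) = V y := max_eq_right hy.le
          rw [h2] at h1
          have h3 := hρeq (V y)
          have h4 : p - V y = Y y ^ 2 := by simp only [hV]; ring
          simp only [hE]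
          rw [← h3, h4]
          calc V' y ^ 2 = 4 * Y y ^ 2 * r (Y y) ^ 2 := by simp only [hV']; ring
            _ = _ := by rw [h1]; field_simp; ring
        have hEder : HasDerivAt E (2 / d * ((η - f (V z)) * V' z)) z := by
          have h1 : HasDerivAt (fun y => F (V y)) (ft (V z) * V' z) z :=
            (hFder (V z)).comp z (hVder z)
          have h2 := (((h1.const_sub (F p)).sub (((hVder z).const_sub p).const_mul η)).const_mul
            (2 / d))
          refine h2.congr_deriv ?_
          rw [hfte _ hz.le]
          ring
        have hEz : E z ≠ 0 := by rw [← hEq.self_of_nhds]; exact pow_ne_zero 2 hV'z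
        have hsq := hEder.sqrt hEz
        have hsqz : Real.sqrt (E z) = |V' z| := by
          rw [← hEq.self_of_nhds, Real.sqrt_sq_eq_abs]
        rcases lt_or_gt_of_ne hV'z with hneg | hpos
        · have h1 : V' =ᶠ[nhds z] fun y => -Real.sqrt (E y) := by
            filter_upwards [hEq, hV'c.continuousAt.eventually (gt_mem_nhds hneg)] with y h1 h2
            rw [← h1, Real.sqrt_sq_eq_abs, abs_of_neg h2, neg_neg]
          refine (hsq.neg.congr_of_eventuallyEq h1).congr_deriv ?_
          rw [hsqz, abs_of_neg hneg]
          field_simp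
        · have h1 : V' =ᶠ[nhds z] fun y => Real.sqrt (E y) := by
            filter_upwards [hEq, hV'c.continuousAt.eventually (lt_mem_nhds hpos)] with y h1 h2
            rw [← h1, Real.sqrt_sq_eq_abs, abs_of_pos h2]
          refine (hsq.congr_of_eventuallyEq h1).congr_deriv ?_
          rw [hsqz, abs_of_pos hpos]
          field_simp
  · intro z hz
    have h1 := hYL z
    have h2 : Real.sqrt p ≤ |Y z| := by
      refine le_trans ?_ h1
      rw [div_le_iff₀ hc0p] at hz
      linarith
    have h3 : p ≤ Y z ^ 2 := by
      have := Real.sq_sqrt hp.le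
      rw [← this, ← sq_abs (Y z)]
      gcongr
    simp only [hV]
    linarith

lemma bump_below (hd : 0 < d) (hu₀ : InX δ h₀ u₀) (hh₀ : 0 < h₀)
    (hsol : ClassicalSolution d δ h₀ (fun _ _ v => f v) u₀ (Ici (0:ℝ)) u g h)
    (hpos : ∀ t ≥ 0, ∀ x ∈ Icc (g t) (h t), 0 < u t x)
    {p η B L : ℝ} {V V' : ℝ → ℝ} (hpδ : p < δ) (hVp : ∀ z, V z ≤ p)
    (hV : ∀ z, HasDerivAt V (V' z) z)
    (hV' : ∀ z, 0 < V z → |V' z| ≤ B ∧ HasDerivAt V' ((η - f (V z)) / d) z)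
    (hVL : ∀ z, L ≤ |z| → V z ≤ 0) (c x0 : ℝ) (hc : |c| * B < η)
    (hx0 : ∀ x ∈ Icc (-h₀) h₀, L ≤ |x - x0|) :
    ∀ t ≥ 0, ∀ x ∈ Icc (g t) (h t), V (x - x0 - c * t) < u t x := by
  intro t ht x hx
  have hsub : Icc 0 t ⊆ Ici (0:ℝ) := fun s hs => hs.1
  have hVc : Continuous V := continuous_iff_continuousAt.2 fun t => (hV t).continuousAt
  have := comp hd hsol 1 g h (fun s y => V (y - x0 - c * s)) 0 t le_rfl
    (hsol.g_reg.continuousOn.mono hsub)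
    (hsol.h_reg.continuousOn.mono hsub) (fun _ _ => le_rfl) (fun _ _ => le_rfl)
    (hVc.comp (by fun_prop)).continuousOn ?_ ?_ ?_ t ⟨ht, le_rfl⟩ x hx
  · linarith
  · intro y hy
    have h1 := hpos 0 le_rfl y hy
    rw [hsol.g_init, hsol.h_init] at hy
    have h2 := hVL (y - x0 - c * 0) (by simpa using hx0 y hy)
    linarith
  · intro s hs
    obtain ⟨h1, h2⟩ := bc hu₀ hh₀ hsol s hs.1
    rw [h1, h2]
    have h3 := hVp (g s - x0 - c * s)
    have h4 := hVp (h s - x0 - c * s)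
    constructor <;> linarith
  · intro s hs y hy huw
    have hup := hpos s hs.1.le y (Ioo_subset_Icc_self hy)
    rw [huw] at hup
    obtain ⟨hB, hxx⟩ := hV' _ hup
    refine ⟨V' (y - x0 - c * s) * -c, (η - f (V (y - x0 - c * s))) / d,
      fun z => V' (z - x0 - c * s), ?_, Eventually.of_forall fun z => ?_, ?_, ?_⟩
    · have h1 : HasDerivAt (fun s : ℝ => y - x0 - c * s) (-c) s := by
        simpa using ((hasDerivAt_id s).const_mul c).const_sub (y - x0)
      exact (hV _).comp s h1
    · have h1 : HasDerivAt (fun z : ℝ => z - x0 - c * s) 1 z :=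
        ((hasDerivAt_id z).sub_const x0).sub_const (c * s)
      have := (hV _).comp z h1
      rw [mul_one] at this
      exact this
    · have h1 : HasDerivAt (fun z : ℝ => z - x0 - c * s) 1 y :=
        ((hasDerivAt_id y).sub_const x0).sub_const (c * s)
      have := HasDerivAt.comp (h₂ := V') y hxx h1
      rw [mul_one] at this
      exact this
    · have h1 : -(V' (y - x0 - c * s) * c) ≤ |c| * B := by
        calc -(V' (y - x0 - c * s) * c) ≤ |V' (y - x0 - c * s) * c| := neg_le_abs _
          _ = |c| * |V' (y - x0 - c * s)| := by rw [abs_mul, mul_comm]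
          _ ≤ |c| * B := by gcongr
      have h2 : d * ((η - f (V (y - x0 - c * s))) / d) = η - f (V (y - x0 - c * s)) := by
        field_simp
      rw [h2]
      linarith

lemma sweep (hd : 0 < d) (hu₀ : InX δ h₀ u₀) (hh₀ : 0 < h₀)
    (hsol : ClassicalSolution d δ h₀ (fun _ _ v => f v) u₀ (Ici (0:ℝ)) u g h)
    (hpos : ∀ t ≥ 0, ∀ x ∈ Icc (g t) (h t), 0 < u t x)
    {p : ℝ} (hpδ : p < δ) (hp : 0 < p) (hfc : ContinuousOn f (Ici 0))
    (hfp : 0 < f p) (hF : ∀ s ∈ Ico 0 p, 0 < ∫ r in s..p, f r) :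
    ∃ T ≥ 0, ∀ t ≥ T, ∀ x ∈ Icc (g t) (h t), p < u t x := by
  obtain ⟨V, V', η, B, L, hη, hB, hL, hV0, hVp, hV, hV', hVL⟩ := bump hd hp hfc hfp hF
  set c := η / (B + 1) with hc
  have hcp : 0 < c := by positivity
  have hcB : |c| * B < η := by
    rw [abs_of_pos hcp, hc, div_mul_eq_mul_div, div_lt_iff₀ (by linarith)]
    nlinarith
  refine ⟨(h₀ + L) / c, by positivity, ?_⟩
  intro t ht x hx
  have ht0 : 0 ≤ t := le_trans (by positivity) ht
  have hct : h₀ + L ≤ c * t := by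
    have : (h₀ + L) / c ≤ t := ht
    rw [div_le_iff₀ hcp] at this
    linarith
  rcases le_total x 0 with hx0 | hx0
  · have := bump_below hd hu₀ hh₀ hsol hpos hpδ hVp hV hV' hVL c (x - c * t) hcB ?_ t ht0 x hx
    · simpa [hV0] using this
    · intro y hy
      exact le_trans (by linarith [hy.1]) (le_abs_self _)
  · have := bump_below hd hu₀ hh₀ hsol hpos hpδ hVp hV hV' hVL (-c) (x + c * t)
      (by rwa [abs_neg]) ?_ t ht0 x hx
    · simpa [hV0] using this
    · intro y hy
      exact le_trans (by linarith [hy.2]) (neg_le_abs _)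

/-- After `u ≥ δ`, `u` becomes strictly larger than `δ` on a fixed interval. -/
lemma ramp (hd : 0 < d)
    (hsol : ClassicalSolution d δ h₀ (fun _ _ v => f v) u₀ (Ici (0:ℝ)) u g h)
    {p : ℝ} (hp0 : 0 < p) (hpδ : p < δ) (hδ1 : δ < 1) (hfc : ContinuousOn f (Ici 0))
    (hfp : ∀ v ∈ Ico p 1, 0 < f v) {T : ℝ} (hT : 0 ≤ T)
    (hu : ∀ t ≥ T, ∀ x ∈ Icc (g t) (h t), δ ≤ u t x) :
    ∃ (T' x0 r μ : ℝ), T < T' ∧ 0 < r ∧ 0 < μ ∧ g T' < x0 - r ∧ x0 + r < h T' ∧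
      ∀ x ∈ Icc (x0 - r) (x0 + r), δ + μ < u T' x := by
  have hgh := hsol.g_lt_h T hT
  set x0 := (g T + h T) / 2 with hx0
  set r := (h T - g T) / 8 with hr
  have hrp : 0 < r := by linarith
  have hgc : ContinuousWithinAt g (Ici T) T :=
    (hsol.g_reg.continuousOn T hT).mono fun s hs => hT.trans hs
  have hhc : ContinuousWithinAt h (Ici T) T :=
    (hsol.h_reg.continuousOn T hT).mono fun s hs => hT.trans hs
  have ev : ∀ᶠ s in nhdsWithin T (Ici T), g s < x0 - 2 * r ∧ x0 + 2 * r < h s :=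
    (hgc.eventually (gt_mem_nhds (by linarith))).and (hhc.eventually (lt_mem_nhds (by linarith)))
  obtain ⟨T1, hT1, hsub⟩ := (mem_nhdsGE_iff_exists_Icc_subset).1 ev
  have hT1 : T < T1 := hT1
  set τ := T1 - T with hτ
  have hτp : 0 < τ := by linarith
  set q := (1 + δ) / 2 with hq
  obtain ⟨vm, hvm, hvmin⟩ := isCompact_Icc.exists_isMinOn
    (⟨p, le_rfl, by linarith⟩ : (Icc p q).Nonempty)
    (hfc.mono fun v hv => by have := hv.1; simp only [mem_Ici]; linarith)
  have hm := hfp vm ⟨hvm.1, by linarith [hvm.2]⟩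
  -- amplitude
  obtain ⟨ε, hε, hε1, hε2, hε3⟩ : ∃ ε > 0, ε * (1 + 2 * d * τ / (2 * r) ^ 2) < f vm ∧
      ε * τ < q - δ ∧ ε * τ < δ - p := by
    have h1 : ∀ᶠ ε in nhdsWithin (0:ℝ) (Ioi 0), ε * (1 + 2 * d * τ / (2 * r) ^ 2) < f vm := by
      have : Tendsto (fun ε : ℝ => ε * (1 + 2 * d * τ / (2 * r) ^ 2)) (nhdsWithin 0 (Ioi 0))
          (nhds (0 * (1 + 2 * d * τ / (2 * r) ^ 2))) :=
        ((continuous_id.mul continuous_const).tendsto 0).mono_left nhdsWithin_le_nhds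
      exact this.eventually (gt_mem_nhds (by simpa using hm))
    have h2 : ∀ᶠ ε in nhdsWithin (0:ℝ) (Ioi 0), ε * τ < min (q - δ) (δ - p) := by
      have : Tendsto (fun ε : ℝ => ε * τ) (nhdsWithin 0 (Ioi 0)) (nhds (0 * τ)) :=
        ((continuous_id.mul continuous_const).tendsto 0).mono_left nhdsWithin_le_nhds
      refine this.eventually (gt_mem_nhds ?_)
      rw [zero_mul]
      exact lt_min (by linarith) (by linarith)
    obtain ⟨ε, ⟨h1, h2⟩, h3⟩ := ((h1.and h2).and self_mem_nhdsWithin).exists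
    exact ⟨ε, h3, h1, lt_of_lt_of_le h2 (min_le_left _ _), lt_of_lt_of_le h2 (min_le_right _ _)⟩
  have hετ : 0 < ε * τ := mul_pos hε hτp
  set R := 2 * r with hR
  have hRp : 0 < R := by linarith
  have key := comp hd hsol 1 (fun _ => x0 - R) (fun _ => x0 + R)
    (fun s x => δ - ε * τ / 4 + ε * (s - T) * (1 - (x - x0) ^ 2 / R ^ 2)) T T1 hT
    continuousOn_const continuousOn_const (fun s hs => (hsub hs).1.le) (fun s hs => (hsub hs).2.le)
    (by fun_prop) ?_ ?_ ?_
  · refine ⟨T1, x0, r, ε * τ / 4, hT1, hrp, by positivity, ?_, ?_, ?_⟩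
    · have := (hsub (show T1 ∈ Icc T T1 from ⟨hT1.le, le_rfl⟩)).1; linarith
    · have := (hsub (show T1 ∈ Icc T T1 from ⟨hT1.le, le_rfl⟩)).2; linarith
    · intro x hx
      have h1 := key T1 ⟨hT1.le, le_rfl⟩ x ⟨by linarith [hx.1], by linarith [hx.2]⟩
      have h2 : (x - x0) ^ 2 / R ^ 2 ≤ 1 / 4 := by
        rw [div_le_iff₀ (by positivity)]
        have : (x - x0) ^ 2 ≤ r ^ 2 := sq_le_sq' (by linarith [hx.1]) (by linarith [hx.2])
        rw [hR]
        nlinarith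
      rw [← hτ] at h1
      have h3 : ε * τ * (3 / 4) ≤ ε * τ * (1 - (x - x0) ^ 2 / R ^ 2) := by
        apply mul_le_mul_of_nonneg_left _ hετ.le
        linarith
      linarith
  · intro x hx
    have h1 := hsub (show T ∈ Icc T T1 from ⟨le_rfl, hT1.le⟩)
    have h2 := hu T le_rfl x ⟨by linarith [hx.1, h1.1], by linarith [hx.2, h1.2]⟩
    simp only [sub_self, mul_zero, zero_mul, add_zero]
    linarith
  · intro s hs
    have h1 := hsub hs
    have h2 := hu s hs.1 (x0 - R) ⟨by linarith [h1.1], by linarith [h1.2]⟩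
    have h3 := hu s hs.1 (x0 + R) ⟨by linarith [h1.1], by linarith [h1.2]⟩
    have e1 : 1 - (x0 - R - x0) ^ 2 / R ^ 2 = 0 := by field_simp; ring
    have e2 : 1 - (x0 + R - x0) ^ 2 / R ^ 2 = 0 := by field_simp; ring
    simp only [e1, e2, mul_zero]
    constructor <;> linarith
  · intro s hs x hx _
    refine ⟨ε * (1 - (x - x0) ^ 2 / R ^ 2), ε * (s - T) * (-2 / R ^ 2),
      fun y => ε * (s - T) * (-(2 * (y - x0)) / R ^ 2), ?_, Eventually.of_forall fun y => ?_, ?_, ?_⟩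
    · have h1 : HasDerivAt (fun s : ℝ => s - T) 1 s := (hasDerivAt_id s).sub_const _
      refine ((((h1.const_mul ε).mul_const _)).const_add _).congr_deriv ?_
      ring
    · have h1 : HasDerivAt (fun y : ℝ => y - x0) 1 y := (hasDerivAt_id y).sub_const _
      refine (((((h1.pow 2).div_const (R ^ 2)).const_sub 1).const_mul (ε * (s - T))).const_add
        _).congr_deriv ?_
      simp
      ring
    · have h1 : HasDerivAt (fun y : ℝ => y - x0) 1 x := (hasDerivAt_id x).sub_const _
      refine ((((h1.const_mul 2).neg).div_const (R ^ 2)).const_mul (ε * (s - T))).congr_deriv ?_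
      ring
    · have hs0 : 0 ≤ s - T := by linarith [hs.1]
      have hs1 : s - T ≤ τ := by linarith [hs.2]
      have hX0 : 0 ≤ (x - x0) ^ 2 / R ^ 2 := by positivity
      have hX1 : (x - x0) ^ 2 / R ^ 2 ≤ 1 := by
        rw [div_le_one (by positivity)]
        exact sq_le_sq' (by linarith [hx.1]) (by linarith [hx.2])
      have ha1 : ε * (s - T) ≤ ε * τ := by gcongr
      have ha0 : 0 ≤ ε * (s - T) := by positivity
      have hb : ε * (s - T) * (1 - (x - x0) ^ 2 / R ^ 2) ≤ ε * τ := by nlinarith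
      have hb0 : 0 ≤ ε * (s - T) * (1 - (x - x0) ^ 2 / R ^ 2) :=
        mul_nonneg ha0 (by linarith)
      have h1 := hvmin (show δ - ε * τ / 4 + ε * (s - T) * (1 - (x - x0) ^ 2 / R ^ 2) ∈ Icc p q from
        ⟨by linarith, by linarith⟩)
      simp only [mem_ofPred_eq] at h1
      have h2 : d * (ε * (s - T) * (2 / R ^ 2)) ≤ d * (ε * τ * (2 / R ^ 2)) := by gcongr
      have h3 : ε * (1 + 2 * d * τ / R ^ 2) = ε + d * (ε * τ * (2 / R ^ 2)) := by ring
      have h4 : d * (ε * (s - T) * (-2 / R ^ 2)) = -(d * (ε * (s - T) * (2 / R ^ 2))) := by ring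
      have h5 : ε * (1 - (x - x0) ^ 2 / R ^ 2) ≤ ε := by nlinarith
      rw [h4]
      linarith

lemma deriv_nonneg_right {φ : ℝ → ℝ} {t c : ℝ} (h : HasDerivAt φ c t) (h0 : φ t = 0)
    (hs : ∀ᶠ s in nhdsWithin t (Ioi t), 0 ≤ φ s) : 0 ≤ c := by
  have := (hasDerivAt_iff_tendsto_slope.1 h).mono_left
    (nhdsWithin_mono t (fun s (hs : s ∈ Ioi t) => ne_of_gt hs))
  refine ge_of_tendsto this ?_
  filter_upwards [hs, self_mem_nhdsWithin] with s h1 h2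
  rw [slope_def_field, h0, sub_zero]
  exact div_nonneg h1 (by simpa using (le_of_lt h2))

/-- The expanding profile. -/
noncomputable def prof (lam A x0 l0 c T : ℝ) (t x : ℝ) : ℝ :=
  1 - A * Real.cosh (lam * (x - x0)) / Real.cosh (lam * (l0 + c * (t - T)))

lemma prof_dx (lam A x0 l0 c T t x : ℝ) :
    HasDerivAt (prof lam A x0 l0 c T t)
      (-(A * (Real.sinh (lam * (x - x0)) * lam) / Real.cosh (lam * (l0 + c * (t - T))))) x := by
  have h1 : HasDerivAt (fun y : ℝ => lam * (y - x0)) lam x := by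
    simpa using ((hasDerivAt_id x).sub_const x0).const_mul lam
  exact ((h1.cosh.const_mul A).div_const _).const_sub 1

lemma prof_dxx (lam A x0 l0 c T t x : ℝ) :
    HasDerivAt (fun y => -(A * (Real.sinh (lam * (y - x0)) * lam) /
        Real.cosh (lam * (l0 + c * (t - T)))))
      (-(lam ^ 2 * (A * Real.cosh (lam * (x - x0)) / Real.cosh (lam * (l0 + c * (t - T)))))) x := by
  have h1 : HasDerivAt (fun y : ℝ => lam * (y - x0)) lam x := by
    simpa using ((hasDerivAt_id x).sub_const x0).const_mul lam
  refine ((((h1.sinh).mul_const lam).const_mul A).div_const _).neg.congr_deriv ?_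
  ring

lemma prof_dt (lam A x0 l0 c T t x : ℝ) :
    HasDerivAt (fun s => prof lam A x0 l0 c T s x)
      (lam * c * (Real.sinh (lam * (l0 + c * (t - T))) / Real.cosh (lam * (l0 + c * (t - T)))) *
        (A * Real.cosh (lam * (x - x0)) / Real.cosh (lam * (l0 + c * (t - T))))) t := by
  have h1 : HasDerivAt (fun s : ℝ => lam * (l0 + c * (s - T))) (lam * c) t := by
    simpa using ((((hasDerivAt_id t).sub_const T).const_mul c).const_add l0).const_mul lam
  have hne := (Real.cosh_pos (lam * (l0 + c * (t - T)))).ne'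
  refine (((hasDerivAt_const t (A * Real.cosh (lam * (x - x0)))).div h1.cosh hne).const_sub
    1).congr_deriv ?_
  field_simp
  ring

lemma expand_compare (hd : 0 < d)
    (hsol : ClassicalSolution d δ h₀ (fun _ _ v => f v) u₀ (Ici (0:ℝ)) u g h)
    {p κ lam x0 l0 c T t1 : ℝ} (hpδ : p < δ) (hδ1 : δ < 1) (hκ : 0 < κ) (hlam : 0 < lam)
    (hlam2 : d * lam ^ 2 = κ / 2) (hfκ : ∀ v ∈ Icc p 1, κ * (1 - v) ≤ f v)
    (hl0 : 0 < l0) (hc : 0 < c) (hc1 : lam * c ≤ κ / 4) (hT : 0 ≤ T)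
    (hu : ∀ t ≥ T, ∀ x ∈ Icc (g t) (h t), δ ≤ u t x)
    (hinit : ∀ x ∈ Icc (x0 - l0) (x0 + l0), 1 - (1 - δ) / Real.cosh (lam * l0) < u T x)
    (hg : ∀ t ∈ Icc T t1, g t ≤ x0 - (l0 + c * (t - T)))
    (hh : ∀ t ∈ Icc T t1, x0 + (l0 + c * (t - T)) ≤ h t) :
    ∀ t ∈ Icc T t1, ∀ x ∈ Icc (x0 - (l0 + c * (t - T))) (x0 + (l0 + c * (t - T))),
      prof lam (1 - δ) x0 l0 c T t x ≤ u t x := by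
  have hratio : ∀ t x, T ≤ t → x ∈ Icc (x0 - (l0 + c * (t - T))) (x0 + (l0 + c * (t - T))) →
      Real.cosh (lam * (x - x0)) ≤ Real.cosh (lam * (l0 + c * (t - T))) := by
    intro t x ht hx
    have hl : 0 ≤ l0 + c * (t - T) := by
      have := mul_nonneg hc.le (sub_nonneg.2 ht); linarith
    rw [Real.cosh_le_cosh, abs_mul, abs_mul]
    refine mul_le_mul_of_nonneg_left ?_ (abs_nonneg _)
    rw [abs_of_nonneg hl, abs_le]
    constructor <;> linarith [hx.1, hx.2]
  have key : ∀ e, 0 < e → e < δ - p → ∀ t ∈ Icc T t1,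
      ∀ x ∈ Icc (x0 - (l0 + c * (t - T))) (x0 + (l0 + c * (t - T))),
      0 < 1 * (u t x - prof lam (1 - δ + e) x0 l0 c T t x) := by
    intro e he hep
    refine comp hd hsol 1 (fun t => x0 - (l0 + c * (t - T))) (fun t => x0 + (l0 + c * (t - T)))
      (prof lam (1 - δ + e) x0 l0 c T) T t1 hT (by fun_prop) (by fun_prop) hg hh ?_ ?_ ?_ ?_
    · refine Continuous.continuousOn ?_
      unfold prof
      refine continuous_const.sub (Continuous.div ?_ ?_ fun q => (Real.cosh_pos _).ne')
      · exact continuous_const.mul (Real.continuous_cosh.comp (by fun_prop))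
      · exact Real.continuous_cosh.comp (by fun_prop)
    · intro x hx
      simp only [sub_self, mul_zero, add_zero] at hx
      have h1 := hinit x hx
      have h2 : (1 - δ) / Real.cosh (lam * l0) ≤
          (1 - δ + e) * Real.cosh (lam * (x - x0)) / Real.cosh (lam * l0) := by
        have := Real.one_le_cosh (lam * (x - x0))
        have := Real.cosh_pos (lam * l0)
        gcongr
        nlinarith
      simp only [prof, sub_self, mul_zero, add_zero]
      linarith
    · intro t ht
      have hl : 0 < l0 + c * (t - T) := by
        have := mul_nonneg hc.le (sub_nonneg.2 ht.1); linarith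
      have h1 := hg t ht
      have h2 := hh t ht
      have h3 := hu t ht.1 (x0 - (l0 + c * (t - T))) ⟨h1, by linarith⟩
      have h4 := hu t ht.1 (x0 + (l0 + c * (t - T))) ⟨by linarith, h2⟩
      have hne := (Real.cosh_pos (lam * (l0 + c * (t - T)))).ne'
      have e1 : prof lam (1 - δ + e) x0 l0 c T t (x0 - (l0 + c * (t - T))) = δ - e := by
        unfold prof
        have : lam * (x0 - (l0 + c * (t - T)) - x0) = -(lam * (l0 + c * (t - T))) := by ring
        rw [this, Real.cosh_neg, mul_div_assoc, div_self hne]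
        ring
      have e2 : prof lam (1 - δ + e) x0 l0 c T t (x0 + (l0 + c * (t - T))) = δ - e := by
        unfold prof
        have : lam * (x0 + (l0 + c * (t - T)) - x0) = (lam * (l0 + c * (t - T))) := by ring
        rw [this, mul_div_assoc, div_self hne]
        ring
      rw [e1, e2]
      constructor <;> linarith
    · intro t ht x hx _
      refine ⟨_, _, _, prof_dt _ _ _ _ _ _ _ _, Eventually.of_forall fun y =>
        prof_dx _ _ _ _ _ _ _ y, prof_dxx _ _ _ _ _ _ _ _, ?_⟩
      have hcp := Real.cosh_pos (lam * (l0 + c * (t - T)))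
      have hA : 0 < 1 - δ + e := by linarith
      set v := (1 - δ + e) * Real.cosh (lam * (x - x0)) / Real.cosh (lam * (l0 + c * (t - T)))
        with hv
      have hvp : 0 < v := by
        have := Real.cosh_pos (lam * (x - x0))
        positivity
      have hv1 : v ≤ 1 - δ + e := by
        rw [hv, div_le_iff₀ hcp]
        exact mul_le_mul_of_nonneg_left (hratio t x ht.1.le (Ioo_subset_Icc_self hx)) hA.le
      have hpv : prof lam (1 - δ + e) x0 l0 c T t x = 1 - v := rfl
      rw [hpv]
      have hfv := hfκ (1 - v) ⟨by linarith, by linarith⟩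
      have hth : Real.sinh (lam * (l0 + c * (t - T))) / Real.cosh (lam * (l0 + c * (t - T))) ≤ 1 := by
        rw [div_le_one hcp]
        have := Real.cosh_sub_sinh (lam * (l0 + c * (t - T)))
        have := Real.exp_pos (-(lam * (l0 + c * (t - T))))
        linarith
      set th := Real.sinh (lam * (l0 + c * (t - T))) / Real.cosh (lam * (l0 + c * (t - T)))
      have hlc : 0 < lam * c := mul_pos hlam hc
      have h1 : lam * c * th * v ≤ κ / 4 * v := by
        apply mul_le_mul_of_nonneg_right _ hvp.le
        nlinarith
      have h2 : d * -(lam ^ 2 * v) = -(κ / 2 * v) := by rw [← hlam2]; ring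
      rw [h2]
      have h3 : 0 < κ * v := mul_pos hκ hvp
      nlinarith
  intro t ht x hx
  refine le_of_forall_pos_lt_add fun e he => ?_
  set e' := min e ((δ - p) / 2) with he'
  have h1 : 0 < e' := lt_min he (by linarith)
  have h2 : e' ≤ e := min_le_left _ _
  have h3 : e' ≤ (δ - p) / 2 := min_le_right _ _
  have h4 := key e' h1 (by linarith) t ht x hx
  have hcp := Real.cosh_pos (lam * (l0 + c * (t - T)))
  have h5 : e' * Real.cosh (lam * (x - x0)) / Real.cosh (lam * (l0 + c * (t - T))) ≤ e' := by
    rw [div_le_iff₀ hcp]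
    exact mul_le_mul_of_nonneg_left (hratio t x ht.1 hx) h1.le
  have h6 : prof lam (1 - δ + e') x0 l0 c T t x = prof lam (1 - δ) x0 l0 c T t x -
      e' * Real.cosh (lam * (x - x0)) / Real.cosh (lam * (l0 + c * (t - T))) := by
    unfold prof
    ring
  rw [h6] at h4
  linarith

/-- First zero of a continuous function of time. -/
lemma first_zero {φ : ℝ → ℝ} {T t1 : ℝ} (hφ : ContinuousOn φ (Icc T t1)) (h0 : 0 < φ T)
    (hT : T ≤ t1) (h1 : φ t1 ≤ 0) :
    ∃ ts ∈ Ioc T t1, φ ts = 0 ∧ ∀ s ∈ Ico T ts, 0 < φ s := by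
  have hcl : IsClosed (Icc T t1 ∩ φ ⁻¹' Iic 0) :=
    hφ.preimage_isClosed_of_isClosed isClosed_Icc isClosed_Iic
  have hc : IsCompact (Icc T t1 ∩ φ ⁻¹' Iic 0) :=
    isCompact_Icc.of_isClosed_subset hcl inter_subset_left
  obtain ⟨ts, ⟨hts, hle⟩, hmin⟩ := hc.exists_isMinOn ⟨t1, ⟨hT, le_rfl⟩, h1⟩ continuous_id.continuousOn
  simp only [mem_preimage, mem_Iic] at hle
  have hbef : ∀ s ∈ Ico T ts, 0 < φ s := by
    intro s hs
    by_contra hcon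
    have := hmin (show s ∈ Icc T t1 ∩ φ ⁻¹' Iic 0 from
      ⟨⟨hs.1, hs.2.le.trans hts.2⟩, not_lt.1 hcon⟩)
    simp only [mem_ofPred_eq, id] at this
    linarith [hs.2]
  have hlt : T < ts := by
    rcases hts.1.eq_or_lt with h | h
    · rw [← h] at hle; linarith
    · exact h
  refine ⟨ts, ⟨hlt, hts.2⟩, le_antisymm hle ?_, hbef⟩
  have hIco : Ico T ts ∈ nhdsWithin ts (Iio ts) := Ico_mem_nhdsLT hlt
  have hlef : nhdsWithin ts (Iio ts) ≤ nhdsWithin ts (Icc T t1) :=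
    le_trans (nhdsWithin_le_of_mem (s := Ico T ts) hIco)
      (nhdsWithin_mono _ fun s hs => ⟨hs.1, hs.2.le.trans hts.2⟩)
  refine ge_of_tendsto ((hφ ts hts).mono_left hlef) ?_
  filter_upwards [hIco] with s hs
  exact (hbef s hs).le

lemma expand (hd : 0 < d)
    (hsol : ClassicalSolution d δ h₀ (fun _ _ v => f v) u₀ (Ici (0:ℝ)) u g h)
    {p κ lam x0 l0 c T : ℝ} (hδ0 : 0 < δ) (hpδ : p < δ) (hδ1 : δ < 1) (hκ : 0 < κ) (hlam : 0 < lam)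
    (hlam2 : d * lam ^ 2 = κ / 2) (hfκ : ∀ v ∈ Icc p 1, κ * (1 - v) ≤ f v)
    (hl0 : 0 < l0) (hc : 0 < c) (hc1 : lam * c ≤ κ / 4)
    (hc2 : c < d / δ * ((1 - δ) * lam * (Real.sinh (lam * l0) / Real.cosh (lam * l0))))
    (hT : 0 ≤ T)
    (hu : ∀ t ≥ T, ∀ x ∈ Icc (g t) (h t), δ ≤ u t x)
    (hinit : ∀ x ∈ Icc (x0 - l0) (x0 + l0), 1 - (1 - δ) / Real.cosh (lam * l0) < u T x)
    (hgT : g T < x0 - l0) (hhT : x0 + l0 < h T) :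
    ∀ t ≥ T, g t < x0 - (l0 + c * (t - T)) ∧ x0 + (l0 + c * (t - T)) < h t := by
  set φ : ℝ → ℝ := fun t => min (x0 - (l0 + c * (t - T)) - g t) (h t - (x0 + (l0 + c * (t - T))))
    with hφ
  suffices hmain : ∀ t ≥ T, 0 < φ t by
    intro t ht
    obtain ⟨h1, h2⟩ := lt_min_iff.1 (hmain t ht)
    exact ⟨by linarith, by linarith⟩
  intro t1 ht1
  by_contra hcon
  have hsub : Icc T t1 ⊆ Ici (0:ℝ) := fun s hs => hT.trans hs.1
  have hφc : ContinuousOn φ (Icc T t1) := by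
    have hgc := hsol.g_reg.continuousOn.mono hsub
    have hhc := hsol.h_reg.continuousOn.mono hsub
    have hl1 : ContinuousOn (fun t : ℝ => x0 - (l0 + c * (t - T))) (Icc T t1) := by fun_prop
    have hl2 : ContinuousOn (fun t : ℝ => x0 + (l0 + c * (t - T))) (Icc T t1) := by fun_prop
    exact ContinuousOn.inf (hl1.sub hgc) (hhc.sub hl2)
  obtain ⟨ts, hts, hz, hbef⟩ := first_zero hφc (lt_min (by simp; linarith) (by simp; linarith)) ht1
    (not_lt.1 hcon)
  have htp : 0 < ts := lt_of_le_of_lt hT hts.1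
  have hge : ∀ s ∈ Icc T ts, 0 ≤ φ s := by
    intro s hs
    rcases hs.2.eq_or_lt with h | h
    · rw [h, hz]
    · exact (hbef s ⟨hs.1, h⟩).le
  have hcmp := expand_compare hd hsol (t1 := ts) hpδ hδ1 hκ hlam hlam2 hfκ hl0 hc hc1 hT hu hinit
    (fun s hs => by have := (le_min_iff.1 (hge s hs)).1; linarith)
    (fun s hs => by have := (le_min_iff.1 (hge s hs)).2; linarith)
    ts ⟨hts.1.le, le_rfl⟩
  set l := l0 + c * (ts - T) with hl
  have hll : l0 ≤ l := by
    have := mul_nonneg hc.le (sub_nonneg.2 hts.1.le); linarith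
  have hlp : 0 < l := by linarith
  -- monotonicity of the hyperbolic tangent
  have hth : Real.sinh (lam * l0) / Real.cosh (lam * l0) ≤
      Real.sinh (lam * l) / Real.cosh (lam * l) := by
    rw [div_le_div_iff₀ (Real.cosh_pos _) (Real.cosh_pos _)]
    have h1 : 0 ≤ Real.sinh (lam * l - lam * l0) :=
      Real.sinh_nonneg_iff.2 (by nlinarith)
    rw [Real.sinh_sub] at h1
    linarith
  have hspeed : c < d / δ * ((1 - δ) * lam * (Real.sinh (lam * l) / Real.cosh (lam * l))) := by
    refine lt_of_lt_of_le hc2 ?_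
    have : 0 ≤ (1 - δ) * lam := mul_nonneg (by linarith) hlam.le
    gcongr
  have hld : HasDerivAt (fun t : ℝ => l0 + c * (t - T)) c ts := by
    simpa using (((hasDerivAt_id ts).sub_const T).const_mul c).const_add l0
  have hIco : Ico T ts ∈ nhdsWithin ts (Iio ts) := Ico_mem_nhdsLT hts.1
  have hnh : Ici (0:ℝ) ∈ nhds ts := Ici_mem_nhds htp
  have hgd : HasDerivAt g (deriv g ts) ts :=
    ((hsol.g_reg.differentiableOn one_ne_zero).differentiableAt hnh).hasDerivAt
  have hhd : HasDerivAt h (deriv h ts) ts :=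
    ((hsol.h_reg.differentiableOn one_ne_zero).differentiableAt hnh).hasDerivAt
  have hgh := hsol.g_lt_h ts htp.le
  have hcne := (Real.cosh_pos (lam * l)).ne'
  have hzz := hz
  simp only [hφ] at hzz
  rcases le_total (x0 - l - g ts) (h ts - (x0 + l)) with hcase | hcase
  · rw [min_eq_left hcase] at hzz
    have hgx : g ts = x0 - l := by linarith
    have d1 : -c - deriv g ts ≤ 0 := by
      refine time_deriv_nonpos (φ := fun t => x0 - (l0 + c * (t - T)) - g t)
        (t := ts) ((hld.const_sub x0).sub hgd) hzz ?_
      filter_upwards [hIco] with s hs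
      exact (lt_min_iff.1 (hbef s hs)).1.le
    have hprof : prof lam (1 - δ) x0 l0 c T ts (g ts) = δ := by
      unfold prof
      rw [hgx, ← hl, show lam * (x0 - l - x0) = -(lam * l) by ring, Real.cosh_neg, mul_div_assoc,
        div_self hcne]
      ring
    have d2 := deriv_nonneg_right (φ := fun y => u ts y - prof lam (1 - δ) x0 l0 c T ts y)
      (t := g ts)
      ((hsol.ux_diff ts htp.le htp (g ts) ⟨le_rfl, hgh.le⟩).hasDerivAt.sub
        (prof_dx lam (1 - δ) x0 l0 c T ts (g ts)))
      (by rw [hprof, hsol.bc_g ts htp.le htp, sub_self]) (by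
        filter_upwards [Ioo_mem_nhdsGT (show g ts < x0 + l by linarith)] with y hy
        exact sub_nonneg.2 (hcmp y ⟨by linarith [hy.1], hy.2.le⟩))
    rw [hgx, ← hl, show lam * (x0 - l - x0) = -(lam * l) by ring, Real.sinh_neg] at d2
    have hst := hsol.stefan_g ts htp.le htp
    rw [hgx] at hst
    have d3 : (1 - δ) * lam * (Real.sinh (lam * l) / Real.cosh (lam * l)) ≤
        deriv (u ts) (x0 - l) := by
      have : -((1 - δ) * (-Real.sinh (lam * l) * lam) / Real.cosh (lam * l)) =
        (1 - δ) * lam * (Real.sinh (lam * l) / Real.cosh (lam * l)) := by ring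
      linarith
    have d4 := mul_le_mul_of_nonneg_left d3 (div_nonneg hd.le hδ0.le)
    linarith
  · rw [min_eq_right hcase] at hzz
    have hgx : h ts = x0 + l := by linarith
    have d1 : deriv h ts - c ≤ 0 := by
      refine time_deriv_nonpos (φ := fun t => h t - (x0 + (l0 + c * (t - T))))
        (t := ts) (hhd.sub (hld.const_add x0)) hzz ?_
      filter_upwards [hIco] with s hs
      exact (lt_min_iff.1 (hbef s hs)).2.le
    have hprof : prof lam (1 - δ) x0 l0 c T ts (h ts) = δ := by
      unfold prof
      rw [hgx, ← hl, show lam * (x0 + l - x0) = lam * l by ring, mul_div_assoc,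
        div_self hcne]
      ring
    have d2 := time_deriv_nonpos (φ := fun y => u ts y - prof lam (1 - δ) x0 l0 c T ts y)
      (t := h ts)
      ((hsol.ux_diff ts htp.le htp (h ts) ⟨hgh.le, le_rfl⟩).hasDerivAt.sub
        (prof_dx lam (1 - δ) x0 l0 c T ts (h ts)))
      (by rw [hprof, hsol.bc_h ts htp.le htp, sub_self]) (by
        filter_upwards [Ioo_mem_nhdsLT (show x0 - l < h ts by linarith)] with y hy
        exact sub_nonneg.2 (hcmp y ⟨hy.1.le, by linarith [hy.2]⟩))
    rw [hgx, ← hl, show lam * (x0 + l - x0) = lam * l by ring] at d2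
    have hst := hsol.stefan_h ts htp.le htp
    rw [hgx] at hst
    have d3 : (1 - δ) * lam * (Real.sinh (lam * l) / Real.cosh (lam * l)) ≤
        -deriv (u ts) (x0 + l) := by
      have : -((1 - δ) * (Real.sinh (lam * l) * lam) / Real.cosh (lam * l)) =
        -((1 - δ) * lam * (Real.sinh (lam * l) / Real.cosh (lam * l))) := by ring
      linarith
    have d4 := mul_le_mul_of_nonneg_left d3 (div_nonneg hd.le hδ0.le)
    linarith

end


lemma lower_lip {f : ℝ → ℝ} (hf : ContDiffOn ℝ 1 f (Ici (0:ℝ))) (h0 : f 0 = 0) :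
    ∃ K : ℝ, 0 ≤ K ∧ ∀ v ∈ Icc (0:ℝ) 1, -K * v ≤ f v := by
  have hdc : ContinuousOn (derivWithin f (Ici (0:ℝ))) (Ici 0) :=
    hf.continuousOn_derivWithin (uniqueDiffOn_Ici 0) le_rfl
  obtain ⟨C, hC⟩ := isCompact_Icc.exists_bound_of_continuousOn
    (hdc.mono (Icc_subset_Ici_self : Icc (0:ℝ) 1 ⊆ Ici 0))
  refine ⟨C, le_trans (norm_nonneg _) (hC 0 (by simp)), ?_⟩
  intro v hv
  have key := (convex_Icc (0:ℝ) 1).norm_image_sub_le_of_norm_hasDerivWithin_le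
    (f := f) (f' := derivWithin f (Ici (0:ℝ))) (C := C) (x := 0) (y := v)
    (fun x hx => ((hf.differentiableOn one_ne_zero x hx.1).hasDerivWithinAt).mono
      Icc_subset_Ici_self) hC (by simp) hv
  rw [h0, sub_zero, sub_zero, Real.norm_eq_abs, Real.norm_eq_abs, abs_of_nonneg hv.1] at key
  linarith [neg_abs_le (f v)]

lemma lower_kappa {f : ℝ → ℝ} {p : ℝ} (hf : ContDiffOn ℝ 1 f (Ici (0:ℝ))) (hp0 : 0 < p)
    (hp1 : p < 1) (h1 : f 1 = 0) (hd1 : derivWithin f (Ici (0:ℝ)) 1 < 0)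
    (hfp : ∀ v ∈ Ico p 1, 0 < f v) :
    ∃ κ : ℝ, 0 < κ ∧ ∀ v ∈ Icc p 1, κ * (1 - v) ≤ f v := by
  have hn : Ici (0:ℝ) ∈ nhds (1:ℝ) := Ici_mem_nhds one_pos
  have hcd : ContinuousOn (dslope f 1) (Ici 0) :=
    (continuousOn_dslope hn).2 ⟨hf.continuousOn,
      (hf.differentiableOn one_ne_zero).differentiableAt hn⟩
  rw [derivWithin_of_mem_nhds hn] at hd1
  obtain ⟨w, hw, hmax⟩ := isCompact_Icc.exists_isMaxOn (nonempty_Icc.2 hp1.le)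
    (hcd.mono (fun x hx => le_trans hp0.le hx.1 : Icc p 1 ⊆ Ici 0))
  have hneg : dslope f 1 w < 0 := by
    rcases eq_or_lt_of_le hw.2 with h | h
    · rw [h, dslope_same]; exact hd1
    · rw [dslope_of_ne _ h.ne, slope_def_field, h1]
      apply div_neg_of_pos_of_neg
      · have := hfp w ⟨hw.1, h⟩
        linarith
      · linarith
  refine ⟨-dslope f 1 w, by linarith, ?_⟩
  intro v hv
  have h2 : dslope f 1 v ≤ dslope f 1 w := hmax hv
  have h3 := sub_smul_dslope f 1 v
  rw [h1, smul_eq_mul] at h3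
  nlinarith [hv.2]

lemma int_pos {f : ℝ → ℝ} {θ θs p : ℝ} (hfc : ContinuousOn f (Ici (0:ℝ))) (hθ0 : 0 ≤ θ)
    (hn : ∀ v ∈ Icc 0 θ, f v ≤ 0) (hpz : ∀ v ∈ Ioo θ 1, 0 < f v) (hp1 : p < 1)
    (hps : θs < p) (hs : θ ≤ θs) (hI : ∀ v ∈ Ioc θs (1:ℝ), 0 < ∫ s in (0:ℝ)..v, f s) :
    ∀ s ∈ Ico 0 p, 0 < ∫ r in s..p, f r := by
  have hii : ∀ a b : ℝ, 0 ≤ a → 0 ≤ b → IntervalIntegrable f MeasureTheory.volume a b := by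
    intro a b ha hb
    apply ContinuousOn.intervalIntegrable
    apply hfc.mono
    intro x hx
    exact le_trans (le_min ha hb) hx.1
  intro s hs'
  rcases le_total θ s with h | h
  · apply intervalIntegral.intervalIntegral_pos_of_pos_on (hii _ _ hs'.1 (by linarith)) _ hs'.2
    intro x hx
    exact hpz x ⟨by linarith [hx.1], by linarith [hx.2]⟩
  · have h1 := intervalIntegral.integral_add_adjacent_intervals
      (hii 0 s le_rfl hs'.1) (hii s p hs'.1 (by linarith))
    have h2 := hI p ⟨hps, hp1.le⟩
    have h3 : ∫ r in (0:ℝ)..s, f r ≤ 0 := by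
      have h4 : ∫ r in (0:ℝ)..s, f r ≤ ∫ r in (0:ℝ)..s, (0:ℝ) :=
        intervalIntegral.integral_mono_on hs'.1 (hii 0 s le_rfl hs'.1)
          intervalIntegrable_const (fun x hx => hn x ⟨hx.1, hx.2.trans h⟩)
      simpa using h4
    linarith

lemma exists_l0 {δ lam r μ : ℝ} (hδ1 : δ < 1) (hr : 0 < r) (hμ : 0 < μ) :
    ∃ l0, 0 < l0 ∧ l0 ≤ r ∧ 1 - (1 - δ) / Real.cosh (lam * l0) < δ + μ := by
  have hc : Tendsto (fun l : ℝ => 1 - (1 - δ) / Real.cosh (lam * l)) (nhds 0)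
      (nhds (1 - (1 - δ) / Real.cosh (lam * 0))) := by
    have : Continuous (fun l : ℝ => 1 - (1 - δ) / Real.cosh (lam * l)) := by
      refine continuous_const.sub (continuous_const.div
        (Real.continuous_cosh.comp (continuous_const.mul continuous_id)) ?_)
      intro x
      exact (Real.cosh_pos _).ne'
    exact this.tendsto 0
  rw [mul_zero, Real.cosh_zero, div_one] at hc
  have h1 := (hc.eventually (gt_mem_nhds (by linarith : 1 - (1 - δ) < δ + μ)))
  obtain ⟨e, he, hb⟩ := Metric.eventually_nhds_iff.1 h1
  refine ⟨min (e / 2) r, lt_min (by linarith) hr, min_le_right _ _, hb ?_⟩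
  have : 0 < min (e / 2) r := lt_min (by linarith) hr
  rw [Real.dist_eq, sub_zero, abs_of_pos this]
  linarith [min_le_left (e / 2) r]

lemma cosh_ge (y : ℝ) : (y + 1) / 2 ≤ Real.cosh y := by
  rw [Real.cosh_eq]
  have := Real.add_one_le_exp y
  have := Real.exp_pos (-y)
  linarith

end Spread

/-- successful spreading for problem (a) with Allee-type `f`
and `δ ∈ (θ*_f, 1)`. -/
theorem spreading_allee (d δ h₀ θ θs : ℝ) (f u₀ : ℝ → ℝ)
    (u : ℝ → ℝ → ℝ) (g h : ℝ → ℝ)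
    (hd : 0 < d) (hh₀ : 0 < h₀)
    (hf : AlleeType f θ) (hθs : IsThetaStar f θ θs) (hδ : δ ∈ Ioo θs 1)
    (hu₀ : InX δ h₀ u₀)
    (hsol : ClassicalSolution d δ h₀ (fun _ _ v => f v) u₀ (Ici (0:ℝ)) u g h) :
    Tendsto g atTop atBot ∧ Tendsto h atTop atTop ∧
      ∀ a b : ℝ, a ≤ b →
        (∃ T > 0, ∀ t ≥ T, g t < a ∧ b < h t) ∧
        (∀ ε > 0, ∃ T > 0, ∀ t ≥ T, ∀ x ∈ Icc a b, |u t x - 1| < ε) := by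
  obtain ⟨hfC, ⟨hθ0, hθ1⟩, f0, fθ, f1, -, hd1, hneg, hposf, hf1, -⟩ := hf
  obtain ⟨⟨hs1, hs2⟩, -, hI⟩ := hθs
  obtain ⟨hδ2, hδ1⟩ := hδ
  have hδ0 : 0 < δ := by linarith
  have hfc := hfC.continuousOn
  obtain ⟨p, hp1, hpδ⟩ := exists_between hδ2
  have hp0 : 0 < p := by linarith
  have hfp : ∀ v ∈ Ico p 1, 0 < f v := fun v hv => hposf v ⟨by linarith [hv.1], hv.2⟩
  obtain ⟨K, hK, hfK⟩ := Spread.lower_lip hfC f0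
  obtain ⟨κ, hκ, hfκ⟩ := Spread.lower_kappa hfC hp0 (hpδ.trans hδ1) f1 hd1 hfp
  have hF := Spread.int_pos hfc hθ0 hneg hposf (hpδ.trans hδ1) hp1 hs1 hI
  have hpos := Spread.pos hd hu₀ hh₀ hsol hδ0 hδ1 hK hfK
  obtain ⟨T1, hT1, hu1⟩ := Spread.sweep hd hu₀ hh₀ hsol hpos hpδ hp0 hfc
    (hfp p ⟨le_rfl, hpδ.trans hδ1⟩) hF
  obtain ⟨T2, hT2, hu2⟩ := Spread.lift hd hu₀ hh₀ hsol hp0 hpδ hfc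
    (fun v hv => hfp v ⟨hv.1, lt_of_le_of_lt hv.2 hδ1⟩) hT1 hu1
  obtain ⟨T, x0, r, μ, hTT, hr, hμ, hgT, hhT, hinit⟩ :=
    Spread.ramp hd hsol hp0 hpδ hδ1 hfc hfp (le_of_lt hT2) hu2
  have hT : 0 < T := lt_trans hT2 hTT
  have hu : ∀ t ≥ T, ∀ x ∈ Icc (g t) (h t), δ ≤ u t x :=
    fun t ht => hu2 t (le_trans hTT.le ht)
  set lam := Real.sqrt (κ / (2 * d)) with hlamdef
  have hlam : 0 < lam := Real.sqrt_pos.2 (by positivity)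
  have hlam2 : d * lam ^ 2 = κ / 2 := by
    rw [hlamdef, Real.sq_sqrt (by positivity)]
    field_simp
  obtain ⟨l0, hl0, hl0r, hl0μ⟩ := Spread.exists_l0 (lam := lam) hδ1 hr hμ
  have hq : 0 < d / δ * ((1 - δ) * lam * (Real.sinh (lam * l0) / Real.cosh (lam * l0))) := by
    have e1 : 0 < Real.sinh (lam * l0) := Real.sinh_pos_iff.2 (mul_pos hlam hl0)
    have e2 := Real.cosh_pos (lam * l0)
    have e3 : 0 < 1 - δ := by linarith
    positivity
  obtain ⟨c, hc, hcm⟩ := exists_between (lt_min (div_pos (by linarith : 0 < κ / 4) hlam) hq)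
  have hc1 : lam * c ≤ κ / 4 := by
    have := (lt_of_lt_of_le hcm (min_le_left _ _)).le
    rw [le_div_iff₀ hlam] at this
    linarith
  have hc2 := lt_of_lt_of_le hcm (min_le_right _ _)
  have hinit' : ∀ x ∈ Icc (x0 - l0) (x0 + l0),
      1 - (1 - δ) / Real.cosh (lam * l0) < u T x := fun x hx =>
    hl0μ.trans (hinit x ⟨by linarith [hx.1], by linarith [hx.2]⟩)
  have hex := Spread.expand hd hsol hδ0 hpδ hδ1 hκ hlam hlam2 hfκ hl0 hc hc1 hc2 hT.le hu
    hinit' (by linarith) (by linarith)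
  have hcmp : ∀ t ≥ T, ∀ x ∈ Icc (x0 - (l0 + c * (t - T))) (x0 + (l0 + c * (t - T))),
      Spread.prof lam (1 - δ) x0 l0 c T t x ≤ u t x := fun t ht =>
    Spread.expand_compare (t1 := t) hd hsol hpδ hδ1 hκ hlam hlam2 hfκ hl0 hc hc1 hT.le hu hinit'
      (fun s hs => (hex s hs.1).1.le) (fun s hs => (hex s hs.1).2.le) t ⟨ht, le_rfl⟩
  -- the comparison interval grows without bound
  have hlin : Tendsto (fun t : ℝ => l0 + c * (t - T)) atTop atTop :=
    tendsto_atTop_add_const_left _ _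
      ((tendsto_atTop_add_const_right atTop (-T) tendsto_id).const_mul_atTop hc)
  have hcov : ∀ R : ℝ, ∃ T' > 0, T ≤ T' ∧ ∀ t ≥ T', R < l0 + c * (t - T) := by
    intro R
    obtain ⟨T', hT'⟩ := eventually_atTop.1 (hlin.eventually_gt_atTop R)
    exact ⟨max T T', lt_max_of_lt_left hT, le_max_left _ _,
      fun t ht => hT' t (le_trans (le_max_right _ _) ht)⟩
  refine ⟨?_, ?_, ?_⟩
  · rw [tendsto_atBot]
    intro b
    obtain ⟨T', -, hTT', hR⟩ := hcov (x0 - b)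
    filter_upwards [eventually_ge_atTop T'] with t ht
    linarith [(hex t (hTT'.trans ht)).1, hR t ht]
  · rw [tendsto_atTop]
    intro b
    obtain ⟨T', -, hTT', hR⟩ := hcov (b - x0)
    filter_upwards [eventually_ge_atTop T'] with t ht
    linarith [(hex t (hTT'.trans ht)).2, hR t ht]
  · intro a b hab
    obtain ⟨T3, hT3, hTT3, hR⟩ := hcov (max (x0 - a) (b - x0))
    have hin : ∀ t ≥ T3, x0 - (l0 + c * (t - T)) < a ∧ b < x0 + (l0 + c * (t - T)) := by
      intro t ht
      have := hR t ht
      have h1 := le_max_left (x0 - a) (b - x0)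
      have h2 := le_max_right (x0 - a) (b - x0)
      exact ⟨by linarith, by linarith⟩
    have hin2 : ∀ t ≥ T3, g t < a ∧ b < h t := fun t ht =>
      ⟨(hex t (hTT3.trans ht)).1.trans (hin t ht).1,
        (hin t ht).2.trans (hex t (hTT3.trans ht)).2⟩
    refine ⟨⟨T3, hT3, hin2⟩, ?_⟩
    intro ε hε
    obtain ⟨T4, hT4, hup⟩ := Spread.upper hd hu₀ hh₀ hsol hδ1 hfc hf1 ε hε
    obtain ⟨M, hM⟩ := isCompact_Icc.exists_bound_of_continuousOn
      (f := fun x => Real.cosh (lam * (x - x0))) (s := Icc a b)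
      (Real.continuous_cosh.comp
        (continuous_const.mul (continuous_id.sub continuous_const))).continuousOn
    obtain ⟨T5, hT5, hTT5, hR5⟩ := hcov (2 * ((1 - δ) * M / ε) / lam)
    refine ⟨max T3 (max T4 T5), lt_max_of_lt_left hT3, ?_⟩
    intro t ht x hx
    have t3 : T3 ≤ t := le_trans (le_max_left _ _) ht
    have t4 : T4 ≤ t := le_trans (le_trans (le_max_left _ _) (le_max_right _ _)) ht
    have t5 : T5 ≤ t := le_trans (le_trans (le_max_right _ _) (le_max_right _ _)) ht
    have hxin : x ∈ Icc (g t) (h t) :=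
      ⟨(hin2 t t3).1.le.trans hx.1, hx.2.trans (hin2 t t3).2.le⟩
    have b1 := hup t t4 x hxin
    have b2 := hcmp t (hTT3.trans t3) x
      ⟨(hin t t3).1.le.trans hx.1, hx.2.trans (hin t t3).2.le⟩
    unfold Spread.prof at b2
    have m1 : Real.cosh (lam * (x - x0)) ≤ M := (le_abs_self _).trans (hM x hx)
    have m2 := hR5 t t5
    rw [div_lt_iff₀ hlam] at m2
    have m3 := Spread.cosh_ge (lam * (l0 + c * (t - T)))
    have m4 : (1 - δ) * M / ε < Real.cosh (lam * (l0 + c * (t - T))) := by linarith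
    have hcp := Real.cosh_pos (lam * (l0 + c * (t - T)))
    rw [div_lt_iff₀ hε] at m4
    have m5 : (1 - δ) * Real.cosh (lam * (x - x0)) ≤ (1 - δ) * M :=
      mul_le_mul_of_nonneg_left m1 (by linarith)
    have m6 : (1 - δ) * Real.cosh (lam * (x - x0)) / Real.cosh (lam * (l0 + c * (t - T))) < ε := by
      rw [div_lt_iff₀ hcp]
      linarith
    rw [abs_lt]
    constructor <;> linarith
end
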